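/- arXiv:2110.07320 — 2 statements merged into one kernel-verified Lean document; each statement's English description precedes it below -/
import Mathlib

section
/- Let ρ and σ be density matrices on ℂ^d, and suppose there exists γ > 0 such that σ·s(ρ) = s(ρ)·σ and ρ = γ·σ·s(ρ). Then for every r ≥ 0, the Hoeffding anti-divergence satisfies H*_r(ρ‖σ) = max(r − D(ρ‖σ), 0). -/
open scoped ENNReal ComplexOrder Classical

namespace QRD

variable {n : Type*} [Fintype n] [DecidableEq n]

/-- Functional calculus for Hermitian matrices (junk value `0` otherwise). -/
noncomputable def matFun (A : Matrix n n ℂ) (f : ℝ → ℝ) : Matrix n n ℂ :=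
  if hA : A.IsHermitian then
    (hA.eigenvectorUnitary : Matrix n n ℂ) *
      Matrix.diagonal (fun i => (f (hA.eigenvalues i) : ℂ)) *
      (star (hA.eigenvectorUnitary : Matrix n n ℂ))
  else 0

/-- The support projection `s(A)` of a Hermitian matrix. -/
noncomputable def supp (A : Matrix n n ℂ) : Matrix n n ℂ :=
  matFun A (fun x => if x = 0 then 0 else 1)

/-- The functional-calculus power `A^t` taken on the support of `A`. -/
noncomputable def matPow (A : Matrix n n ℂ) (t : ℝ) : Matrix n n ℂ :=
  matFun A (fun x => if x = 0 then 0 else x ^ t)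

/-- The functional-calculus logarithm taken on the support of `A`. -/
noncomputable def matLog (A : Matrix n n ℂ) : Matrix n n ℂ :=
  matFun A Real.log

/-- `suppLE ρ σ` means `s(ρ) ≤ s(σ)`, i.e. `ker σ ⊆ ker ρ`. -/
def suppLE (ρ σ : Matrix n n ℂ) : Prop :=
  LinearMap.ker σ.mulVecLin ≤ LinearMap.ker ρ.mulVecLin

/-- Loewner order: `A ≤ B` iff `B - A` is positive semidefinite. -/
def loewnerLE (A B : Matrix n n ℂ) : Prop := (B - A).PosSemidef

/-- A density matrix: positive semidefinite with unit trace. -/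
def IsDensityMatrix (ρ : Matrix n n ℂ) : Prop := ρ.PosSemidef ∧ ρ.trace = 1

/-- The quantity `Q^*_α(ρ‖σ)`, with values in `[0,∞]`. -/
noncomputable def Qstar (α : ℝ) (ρ σ : Matrix n n ℂ) : ℝ≥0∞ :=
  if 1 < α ∧ ¬ suppLE ρ σ then ⊤
  else ENNReal.ofReal
    ((matPow (matPow σ ((1 - α) / (2 * α)) * ρ * matPow σ ((1 - α) / (2 * α))) α).trace.re)

/-- The sandwiched Rényi `α`-divergence `D^*_α(ρ‖σ)`. -/
noncomputable def Dstar (α : ℝ) (ρ σ : Matrix n n ℂ) : EReal :=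
  (((α - 1)⁻¹ : ℝ) : EReal) * (Qstar α ρ σ).log

/-- The Hoeffding anti-divergence `H^*_r(ρ‖σ)`. -/
noncomputable def Hstar (r : ℝ) (ρ σ : Matrix n n ℂ) : EReal :=
  ⨆ α ∈ Set.Ioi (1 : ℝ), ((((α - 1) / α : ℝ) : EReal) * ((r : EReal) - Dstar α ρ σ))

/-- The Umegaki relative entropy `D(ρ‖σ)`. -/
noncomputable def Drel (ρ σ : Matrix n n ℂ) : EReal :=
  if suppLE ρ σ then (((ρ * (matLog ρ - matLog σ)).trace.re : ℝ) : EReal) else ⊤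

/-- The max-relative entropy `D_max(ρ‖σ)`. -/
noncomputable def Dmax (ρ σ : Matrix n n ℂ) : EReal :=
  if ∃ γ : ℝ, 0 ≤ γ ∧ loewnerLE ρ (γ • σ) then
    ((Real.log (sInf {γ : ℝ | 0 ≤ γ ∧ loewnerLE ρ (γ • σ)}) : ℝ) : EReal)
  else ⊤

/-- The `n`-fold Kronecker tensor power of a `d × d` matrix. -/
noncomputable def tensorPow {d : ℕ} (ρ : Matrix (Fin d) (Fin d) ℂ) (N : ℕ) :
    Matrix (Fin N → Fin d) (Fin N → Fin d) ℂ :=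
  Matrix.of fun x y => ∏ i, ρ (x i) (y i)

/-- A (quantum) test: `0 ≤ T ≤ 1` in the Loewner order. -/
def IsTest {m : Type*} [Fintype m] [DecidableEq m] (T : Matrix m m ℂ) : Prop :=
  T.PosSemidef ∧ (1 - T).PosSemidef

/-- `-(1/n) log x`, with the convention `-log 0 = +∞`. -/
noncomputable def expRate (N : ℕ) (x : ℝ) : EReal :=
  if x = 0 then ⊤ else ((-(N : ℝ)⁻¹ * Real.log x : ℝ) : EReal)

end QRD

open Polynomial in
/-- On a finite set of nodes containing `0`, a function vanishing at `0` agrees with a polynomial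
without constant term. -/
lemma exists_X_mul_eval_eq {s : Set ℝ} (hs : s.Finite) {f : ℝ → ℝ} (hf : f 0 = 0) :
    ∃ q : ℝ[X], ∀ x ∈ s, (X * q).eval x = f x := by
  refine ⟨Lagrange.interpolate hs.toFinset id (fun x => x⁻¹ * f x), fun x hx => ?_⟩
  have h := Lagrange.eval_interpolate_at_node (s := hs.toFinset) (v := id)
    (fun x => x⁻¹ * f x) (Set.injOn_id _) (hs.mem_toFinset.2 hx)
  rw [eval_mul, eval_X]
  simp only [id] at h
  rw [h]
  rcases eq_or_ne x 0 with rfl | hx0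
  · simp [hf]
  · field_simp

namespace QRD

section FunctionalCalculus

variable {n : Type*} [Fintype n] [DecidableEq n] {A P : Matrix n n ℂ}

lemma matFun_eq_cfc (hA : A.IsHermitian) (f : ℝ → ℝ) : matFun A f = cfc f A := by
  rw [hA.cfc_eq, matFun, dif_pos hA, Matrix.IsHermitian.cfc, Unitary.conjStarAlgAut_apply]
  rfl

lemma continuousOn_spectrum (A : Matrix n n ℂ) (f : ℝ → ℝ) : ContinuousOn f (spectrum ℝ A) :=
  (Matrix.finite_real_spectrum (A := A)).continuousOn f

lemma continuousOn_image_spectrum (A : Matrix n n ℂ) (f g : ℝ → ℝ) :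
    ContinuousOn g (f '' spectrum ℝ A) :=
  ((Matrix.finite_real_spectrum (A := A)).image f).continuousOn g

lemma cfc_mul_matrix (f g : ℝ → ℝ) (A : Matrix n n ℂ) :
    cfc (fun x => f x * g x) A = cfc f A * cfc g A :=
  cfc_mul f g A (continuousOn_spectrum A f) (continuousOn_spectrum A g)

lemma isHermitian_cfc (f : ℝ → ℝ) (A : Matrix n n ℂ) : (cfc f A).IsHermitian :=
  cfc_predicate f A

lemma spectrum_nonneg (hA : A.PosSemidef) {x : ℝ} (hx : x ∈ spectrum ℝ A) : 0 ≤ x := by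
  rw [hA.isHermitian.spectrum_real_eq_range_eigenvalues] at hx
  obtain ⟨i, rfl⟩ := hx
  exact hA.eigenvalues_nonneg i

open Polynomial in
/-- Functional calculus of the compression of a Hermitian matrix by a commuting projection. -/
lemma cfc_mul_projection (hA : A.IsHermitian) (hP : P.IsHermitian) (hPP : P * P = P)
    (hAP : Commute A P) {f : ℝ → ℝ} (hf : f 0 = 0) :
    cfc f (A * P) = cfc f A * P := by
  have hH : (A * P).IsHermitian := by
    rw [Matrix.IsHermitian, Matrix.conjTranspose_mul, hA.eq, hP.eq, hAP.eq]
  obtain ⟨q, hq⟩ := exists_X_mul_eval_eq ((Matrix.finite_real_spectrum (A := A)).union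
    (Matrix.finite_real_spectrum (A := A * P))) hf
  have hpow (k : ℕ) : (A * P) ^ k * P = A ^ k * P := by
    rw [hAP.mul_pow, mul_assoc, ← pow_succ, IsIdempotentElem.pow_succ_eq k hPP]
  have hq' (p : ℝ[X]) : aeval (A * P) p * P = aeval A p * P := by
    induction p using Polynomial.induction_on with
    | C r => simp
    | add p₁ p₂ h₁ h₂ => rw [map_add, map_add, add_mul, add_mul, h₁, h₂]
    | monomial k r _ => simp only [map_mul, aeval_C, map_pow, aeval_X, mul_assoc, hpow]
  have hf₁ : cfc (X * q).eval (A * P) = cfc f (A * P) := cfc_congr fun x hx => hq x (.inr hx)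
  have hf₂ : cfc (X * q).eval A = cfc f A := cfc_congr fun x hx => hq x (.inl hx)
  rw [← hf₁, ← hf₂, cfc_polynomial _ _ hH.isSelfAdjoint, cfc_polynomial _ _ hA.isSelfAdjoint, ← hq']
  have : aeval (A * P) (X * q) = aeval (A * P) q * (A * P) := by
    rw [mul_comm, map_mul, aeval_X]
  rw [this, mul_assoc, mul_assoc, hPP]

/-- Functional calculus of the compression of `cfc g A` by a projection commuting with `A`. -/
lemma cfc_cfc_mul_projection (hA : A.IsHermitian) (hP : P.IsHermitian) (hPP : P * P = P)
    (hAP : Commute A P) {f : ℝ → ℝ} (hf : f 0 = 0) (g : ℝ → ℝ) :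
    cfc f (cfc g A * P) = cfc (fun x => f (g x)) A * P := by
  rw [cfc_mul_projection (isHermitian_cfc g A) hP hPP (hAP.cfc_real g) hf,
    ← cfc_comp' f g A (continuousOn_image_spectrum A g f) (continuousOn_spectrum A g)
      hA.isSelfAdjoint]

lemma isHermitian_supp (hA : A.IsHermitian) : (supp A).IsHermitian := by
  rw [supp, matFun_eq_cfc hA]
  exact isHermitian_cfc _ _

lemma supp_mul_supp (hA : A.IsHermitian) : supp A * supp A = supp A := by
  rw [supp, matFun_eq_cfc hA, ← cfc_mul_matrix]
  congr 1
  ext x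
  split_ifs <;> simp

lemma mul_supp (hA : A.IsHermitian) : A * supp A = A := by
  rw [supp, matFun_eq_cfc hA]
  nth_rw 1 [← cfc_id' ℝ A hA.isSelfAdjoint]
  rw [← cfc_mul_matrix]
  conv_rhs => rw [← cfc_id' ℝ A hA.isSelfAdjoint]
  congr 1
  ext x
  split_ifs with h <;> simp [h]

end FunctionalCalculus

section Proportional

variable {n : Type*} [Fintype n] [DecidableEq n] {ρ σ : Matrix n n ℂ} {γ : ℝ}

lemma suppLE_of_eq_smul_mul_supp (hcomm : σ * supp ρ = supp ρ * σ)
    (hρσ : ρ = γ • (σ * supp ρ)) : suppLE ρ σ := by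
  intro x hx
  rw [LinearMap.mem_ker, Matrix.mulVecLin_apply] at hx ⊢
  rw [hρσ, hcomm, Matrix.smul_mulVec, ← Matrix.mulVec_mulVec, hx, Matrix.mulVec_zero, smul_zero]

lemma cfc_mul_supp_of_eq_smul (hσ : σ.IsHermitian) (hρσ : ρ = γ • (σ * supp ρ)) :
    cfc (fun x => γ * x) σ * supp ρ = ρ := by
  rw [cfc_const_mul_id γ σ hσ.isSelfAdjoint, Matrix.smul_mul, ← hρσ]

lemma rpow_sandwich_eq_cfc (hσ : σ.PosSemidef)
    (hcomm : σ * supp ρ = supp ρ * σ) (hρσ : ρ = γ • (σ * supp ρ)) {α : ℝ} (hα : 1 < α) :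
    matPow σ ((1 - α) / (2 * α)) * ρ * matPow σ ((1 - α) / (2 * α)) =
      cfc (fun x => γ * x ^ α⁻¹) σ * supp ρ := by
  set s := (1 - α) / (2 * α) with hs
  have hα0 : α ≠ 0 := by positivity
  have hsα : s + 1 + s = α⁻¹ := by rw [hs]; field_simp; ring
  rw [matPow, matFun_eq_cfc hσ.isHermitian]
  nth_rw 1 [← cfc_mul_supp_of_eq_smul hσ.isHermitian hρσ]
  have hc : Commute (cfc (fun x : ℝ => if x = 0 then 0 else x ^ s) σ) (supp ρ) :=
    Commute.cfc_real hcomm _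
  rw [mul_assoc, mul_assoc, ← hc.eq, ← mul_assoc, ← mul_assoc, ← cfc_mul_matrix,
    ← cfc_mul_matrix]
  congr 1
  refine cfc_congr fun x hx => ?_
  rcases (spectrum_nonneg hσ hx).eq_or_lt with rfl | hx0
  · simp [Real.zero_rpow (inv_ne_zero hα0)]
  · simp only [hx0.ne', if_false]
    rw [← hsα, Real.rpow_add hx0, Real.rpow_add hx0, Real.rpow_one]
    ring

lemma matPow_sandwich (hρ : ρ.IsHermitian) (hσ : σ.PosSemidef) (hγ : 0 < γ)
    (hcomm : σ * supp ρ = supp ρ * σ) (hρσ : ρ = γ • (σ * supp ρ)) {α : ℝ} (hα : 1 < α) :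
    matPow (matPow σ ((1 - α) / (2 * α)) * ρ * matPow σ ((1 - α) / (2 * α))) α =
      γ ^ (α - 1) • ρ := by
  have hα0 : 0 < α := by positivity
  have hP := isHermitian_supp hρ
  have hcomm' : Commute (cfc (fun x : ℝ => γ * x ^ α⁻¹) σ) (supp ρ) := Commute.cfc_real hcomm _
  rw [rpow_sandwich_eq_cfc hσ hcomm hρσ hα, matPow, matFun_eq_cfc,
    cfc_cfc_mul_projection hσ.isHermitian hP (supp_mul_supp hρ) hcomm (by simp)]
  · nth_rw 2 [← cfc_mul_supp_of_eq_smul hσ.isHermitian hρσ]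
    rw [← Matrix.smul_mul, ← cfc_const_mul _ _ _ (continuousOn_spectrum _ _)]
    congr 1
    refine cfc_congr fun x hx => ?_
    rcases (spectrum_nonneg hσ hx).eq_or_lt with rfl | hx0
    · simp [Real.zero_rpow (inv_ne_zero hα0.ne')]
    · have : 0 < γ * x ^ α⁻¹ := by positivity
      simp only [this.ne', if_false]
      rw [Real.mul_rpow hγ.le (by positivity), ← Real.rpow_mul hx0.le,
        inv_mul_cancel₀ hα0.ne', Real.rpow_one, Real.rpow_sub_one hγ.ne']
      field_simp
  · rw [Matrix.IsHermitian, Matrix.conjTranspose_mul, hP.eq, (isHermitian_cfc _ σ).eq, hcomm'.eq]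

lemma Dstar_eq_log (hρ : IsDensityMatrix ρ) (hσ : σ.PosSemidef) (hγ : 0 < γ)
    (hcomm : σ * supp ρ = supp ρ * σ) (hρσ : ρ = γ • (σ * supp ρ)) {α : ℝ} (hα : 1 < α) :
    Dstar α ρ σ = (Real.log γ : ℝ) := by
  rw [Dstar, Qstar, if_neg fun h => h.2 (suppLE_of_eq_smul_mul_supp hcomm hρσ),
    matPow_sandwich hρ.1.isHermitian hσ hγ hcomm hρσ hα, Matrix.trace_smul, hρ.2]
  have hα' : α - 1 ≠ 0 := by linarith
  have hpow : 0 < γ ^ (α - 1) := by positivity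
  have : (γ ^ (α - 1) • (1 : ℂ)).re = γ ^ (α - 1) := by simp
  rw [this, ENNReal.log_ofReal_of_pos hpow, Real.log_rpow hγ, ← EReal.coe_mul,
    inv_mul_cancel_left₀ hα']

lemma Drel_eq_log (hρ : IsDensityMatrix ρ) (hσ : σ.PosSemidef) (hγ : 0 < γ)
    (hcomm : σ * supp ρ = supp ρ * σ) (hρσ : ρ = γ • (σ * supp ρ)) :
    Drel ρ σ = (Real.log γ : ℝ) := by
  have hρH := hρ.1.isHermitian
  have hlog : matLog ρ = cfc (fun x => Real.log (γ * x)) σ * supp ρ := by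
    rw [matLog, matFun_eq_cfc hρH]
    nth_rw 1 [← cfc_mul_supp_of_eq_smul hσ.isHermitian hρσ]
    exact cfc_cfc_mul_projection hσ.isHermitian (isHermitian_supp hρH) (supp_mul_supp hρH) hcomm
      Real.log_zero _
  have hsupp (f : ℝ → ℝ) : ρ * cfc f σ = cfc (fun x => γ * x * f x) σ * supp ρ := by
    nth_rw 1 [← cfc_mul_supp_of_eq_smul hσ.isHermitian hρσ]
    rw [mul_assoc, ← (Commute.cfc_real hcomm f).eq, ← mul_assoc, ← cfc_mul_matrix]
  have hmul : ρ * (matLog ρ - matLog σ) = Real.log γ • ρ := by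
    rw [mul_sub, hlog, ← mul_assoc, hsupp, mul_assoc, supp_mul_supp hρH, matLog,
      matFun_eq_cfc hσ.isHermitian, hsupp, ← sub_mul,
      ← cfc_sub _ _ σ (continuousOn_spectrum _ _) (continuousOn_spectrum _ _)]
    nth_rw 2 [← cfc_mul_supp_of_eq_smul hσ.isHermitian hρσ]
    rw [← Matrix.smul_mul, ← cfc_const_mul _ _ _ (continuousOn_spectrum _ _)]
    congr 1
    refine cfc_congr fun x _ => ?_
    rcases eq_or_ne x 0 with rfl | hx0
    · simp
    · simp only [Real.log_mul hγ.ne' hx0]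
      ring
  rw [Drel, if_pos (suppLE_of_eq_smul_mul_supp hcomm hρσ), hmul, Matrix.trace_smul, hρ.2]
  simp

end Proportional

lemma iSup_sub_one_div_mul_eq_max (c : ℝ) :
    ⨆ α ∈ Set.Ioi (1 : ℝ), (((α - 1) / α * c : ℝ) : EReal) = ((max c 0 : ℝ) : EReal) := by
  have hlim : Filter.Tendsto (fun t : ℝ => ((t * c : ℝ) : EReal)) (nhds 1) (nhds (c : EReal)) := by
    have : Continuous fun t : ℝ => ((t * c : ℝ) : EReal) := continuous_coe_real_ereal.comp (by fun_prop)
    simpa using this.tendsto 1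
  have hlim0 : Filter.Tendsto (fun t : ℝ => ((t * c : ℝ) : EReal)) (nhds 0) (nhds (0 : EReal)) := by
    have : Continuous fun t : ℝ => ((t * c : ℝ) : EReal) := continuous_coe_real_ereal.comp (by fun_prop)
    simpa using this.tendsto 0
  have hmem {t : ℝ} (h0 : 0 < t) (h1 : t < 1) : ((t * c : ℝ) : EReal) ≤
      ⨆ α ∈ Set.Ioi (1 : ℝ), (((α - 1) / α * c : ℝ) : EReal) := by
    have h1' : 0 < 1 - t := by linarith
    have : t = ((1 - t)⁻¹ - 1) / (1 - t)⁻¹ := by field_simp; ring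
    rw [this]
    exact le_iSup₂_of_le (1 - t)⁻¹ ((one_lt_inv₀ h1').2 (by linarith)) le_rfl
  apply le_antisymm
  · refine iSup₂_le fun α hα => EReal.coe_le_coe_iff.2 ?_
    have hα1 : 1 < α := hα
    have h0 : 0 ≤ (α - 1) / α := div_nonneg (by linarith) (by linarith)
    have h1 : (α - 1) / α ≤ 1 := (div_le_one (by linarith)).2 (by linarith)
    calc (α - 1) / α * c ≤ (α - 1) / α * max c 0 := by gcongr; exact le_max_left _ _
      _ ≤ max c 0 := mul_le_of_le_one_left (le_max_right _ _) h1
  · rw [EReal.coe_strictMono.monotone.map_max]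
    refine max_le ?_ ?_
    · refine le_of_tendsto (hlim.mono_left (nhdsWithin_le_nhds (s := Set.Iio 1))) ?_
      filter_upwards [Ioo_mem_nhdsLT zero_lt_one] with t ht using hmem ht.1 ht.2
    · refine le_of_tendsto (hlim0.mono_left (nhdsWithin_le_nhds (s := Set.Ioi 0))) ?_
      filter_upwards [Ioo_mem_nhdsGT zero_lt_one] with t ht using hmem ht.1 ht.2

end QRD

open QRD in
/-- If `ρ`, `σ` are density matrices on `ℂ^d` and there is `γ > 0` with
`σ·s(ρ) = s(ρ)·σ` and `ρ = γ·σ·s(ρ)`, then for every `r ≥ 0` the Hoeffding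
anti-divergence satisfies `H*_r(ρ‖σ) = max(r − D(ρ‖σ), 0)`. -/
theorem hoeffdingAntiDivergence_eq_max
    {d : ℕ} (ρ σ : Matrix (Fin d) (Fin d) ℂ)
    (hρ : IsDensityMatrix ρ) (hσ : IsDensityMatrix σ)
    (γ : ℝ) (hγ : 0 < γ)
    (hcomm : σ * supp ρ = supp ρ * σ)
    (hρσ : ρ = γ • (σ * supp ρ))
    (r : ℝ) (hr : 0 ≤ r) :
    Hstar r ρ σ = max ((r : EReal) - Drel ρ σ) 0 := by
  rw [Drel_eq_log hρ hσ.1 hγ hcomm hρσ, ← EReal.coe_sub, ← EReal.coe_zero, ← EReal.coe_strictMono.monotone.map_max,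
    ← iSup_sub_one_div_mul_eq_max, Hstar]
  refine iSup_congr fun α => iSup_congr fun hα => ?_
  rw [Dstar_eq_log hρ hσ.1 hγ hcomm hρσ hα, ← EReal.coe_sub, ← EReal.coe_mul]
end

section
/- Let ρ and σ be density matrices on ℂ^d with s(ρ) ≤ s(σ). Then for every r ≥ 0 the strong converse exponent sc̲_r(ρ‖σ) equals the Hoeffding anti-divergence H*_r(ρ‖σ). -/
open scoped ENNReal ComplexOrder Classical

namespace QRD

/-- The strong converse exponent `sc̲_r(ρ‖σ)`: the infimum of
`liminf_n −(1/n) log Tr(ρ^{⊗n} T_n)` over all test sequences `{T_n}` with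
`liminf_n −(1/n) log Tr(σ^{⊗n} T_n) ≥ r` (with the convention `−log 0 = +∞`). -/
noncomputable def scLow {d : ℕ} (r : ℝ) (ρ σ : Matrix (Fin d) (Fin d) ℂ) : EReal :=
  sInf {x : EReal |
    ∃ T : (N : ℕ) → Matrix (Fin N → Fin d) (Fin N → Fin d) ℂ,
      (∀ N, IsTest (T N)) ∧
      (r : EReal) ≤ Filter.liminf
        (fun N => expRate N ((tensorPow σ N * T N).trace.re)) Filter.atTop ∧
      x = Filter.liminf
        (fun N => expRate N ((tensorPow ρ N * T N).trace.re)) Filter.atTop}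

end QRD

set_option linter.unusedSectionVars false

namespace QRD

section LinearAlgebra

open Matrix

variable {n : Type*} [Fintype n] [DecidableEq n]

/-- The complex diagonal matrix with the given real entries. -/
noncomputable def realDiag (a : n → ℝ) : Matrix n n ℂ := diagonal fun i => (a i : ℂ)

lemma realDiag_mul (a b : n → ℝ) : realDiag a * realDiag b = realDiag fun i => a i * b i := by
  simp [realDiag]

lemma realDiag_conjTranspose (a : n → ℝ) : (realDiag a)ᴴ = realDiag a := by
  simp only [realDiag, diagonal_conjTranspose]
  congr 1
  ext i
  simp

lemma mul_conjTranspose_eq_one {U : Matrix n n ℂ} (hU : Uᴴ * U = 1) : U * Uᴴ = 1 :=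
  mul_eq_one_comm.mp hU

lemma exists_unitary_realDiag {A : Matrix n n ℂ} (hA : A.IsHermitian) :
    ∃ (U : Matrix n n ℂ) (a : n → ℝ), Uᴴ * U = 1 ∧ A = U * realDiag a * Uᴴ := by
  refine ⟨hA.eigenvectorUnitary, hA.eigenvalues, ?_, ?_⟩
  · have := Unitary.coe_star_mul_self hA.eigenvectorUnitary
    simpa [star_eq_conjTranspose] using this
  · have := hA.spectral_theorem
    rw [Unitary.conjStarAlgAut_apply] at this
    exact this

lemma posSemidef_conj {A : Matrix n n ℂ} (hA : A.PosSemidef) (U : Matrix n n ℂ) :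
    (Uᴴ * A * U).PosSemidef := hA.conjTranspose_mul_mul_same U

lemma conj_cancel {A B U : Matrix n n ℂ} (hU : Uᴴ * U = 1) (hA : A = U * B * Uᴴ) :
    Uᴴ * A * U = B := by
  rw [hA]
  calc Uᴴ * (U * B * Uᴴ) * U = (Uᴴ * U) * B * (Uᴴ * U) := by noncomm_ring
    _ = B := by rw [hU]; simp

lemma trace_conj {A U : Matrix n n ℂ} (hU : Uᴴ * U = 1) : (U * A * Uᴴ).trace = A.trace := by
  rw [trace_mul_comm, ← Matrix.mul_assoc, hU, Matrix.one_mul]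

lemma isHermitian_conj_realDiag (U : Matrix n n ℂ) (a : n → ℝ) :
    (U * realDiag a * Uᴴ).IsHermitian := by
  unfold Matrix.IsHermitian
  simp [conjTranspose_mul, realDiag_conjTranspose, Matrix.mul_assoc]

lemma PosSemidef.exists_unitary_realDiag {A : Matrix n n ℂ} (hA : A.PosSemidef) :
    ∃ (U : Matrix n n ℂ) (a : n → ℝ), Uᴴ * U = 1 ∧ A = U * realDiag a * Uᴴ ∧ ∀ i, 0 ≤ a i := by
  obtain ⟨U, a, hU, h⟩ := QRD.exists_unitary_realDiag hA.isHermitian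
  refine ⟨U, a, hU, h, fun i => ?_⟩
  have h1 := (posSemidef_conj hA U).diag_nonneg (i := i)
  rw [conj_cancel hU h] at h1
  simpa [realDiag] using h1

/-- The functional calculus can be computed in any orthonormal eigenbasis. -/
lemma matFun_eq {A U : Matrix n n ℂ} {a : n → ℝ} (hU : Uᴴ * U = 1)
    (hA : A = U * realDiag a * Uᴴ) (f : ℝ → ℝ) :
    matFun A f = U * realDiag (fun i => f (a i)) * Uᴴ := by
  have hH : A.IsHermitian := hA ▸ isHermitian_conj_realDiag U a
  have hV : (hH.eigenvectorUnitary : Matrix n n ℂ)ᴴ * hH.eigenvectorUnitary = 1 := by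
    have := Unitary.coe_star_mul_self hH.eigenvectorUnitary
    simpa [star_eq_conjTranspose] using this
  have hA' : A = (hH.eigenvectorUnitary : Matrix n n ℂ) * realDiag hH.eigenvalues *
      (hH.eigenvectorUnitary : Matrix n n ℂ)ᴴ := by
    have := hH.spectral_theorem
    rw [Unitary.conjStarAlgAut_apply] at this
    exact this
  have hdef : matFun A f = (hH.eigenvectorUnitary : Matrix n n ℂ) *
      realDiag (fun i => f (hH.eigenvalues i)) * (hH.eigenvectorUnitary : Matrix n n ℂ)ᴴ := by
    unfold matFun
    rw [dif_pos hH]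
    rfl
  rw [hdef]
  generalize (hH.eigenvectorUnitary : Matrix n n ℂ) = V at *
  generalize hH.eigenvalues = b at *
  set W := Uᴴ * V with hW
  have hVU : V = U * W := by
    rw [hW, ← Matrix.mul_assoc, mul_conjTranspose_eq_one hU, Matrix.one_mul]
  have h1 : realDiag a * W = W * realDiag b := by
    have e1 : Uᴴ * A * V = realDiag a * W := by
      rw [hA, hW]
      calc Uᴴ * (U * realDiag a * Uᴴ) * V = (Uᴴ * U) * realDiag a * (Uᴴ * V) := by noncomm_ring
        _ = _ := by rw [hU, Matrix.one_mul]
    have e2 : Uᴴ * A * V = W * realDiag b := by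
      rw [hA', hW]
      calc Uᴴ * (V * realDiag b * Vᴴ) * V = (Uᴴ * V) * realDiag b * (Vᴴ * V) := by noncomm_ring
        _ = _ := by rw [hV, Matrix.mul_one]
    rw [← e1, e2]
  have h2 : realDiag (fun i => f (a i)) * W = W * realDiag (fun i => f (b i)) := by
    ext i j
    have := congrFun (congrFun h1 i) j
    simp only [realDiag, diagonal_mul, mul_diagonal] at this ⊢
    by_cases hw : W i j = 0
    · simp [hw]
    · have hab : (a i : ℂ) = b j := by
        rw [mul_comm] at this
        exact mul_left_cancel₀ hw this
      have hab' : a i = b j := by exact_mod_cast hab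
      rw [hab', mul_comm]
  calc V * realDiag (fun i => f (b i)) * Vᴴ
      = U * (W * realDiag (fun i => f (b i))) * Vᴴ := by rw [hVU]; noncomm_ring
    _ = U * realDiag (fun i => f (a i)) * (W * Vᴴ) := by rw [← h2]; noncomm_ring
    _ = _ := by
      rw [hW, Matrix.mul_assoc Uᴴ, mul_conjTranspose_eq_one hV, Matrix.mul_one]

/-- The scalar function underlying `matPow`. -/
noncomputable def suppRpow (t x : ℝ) : ℝ := if x = 0 then 0 else x ^ t

lemma matPow_eq {A U : Matrix n n ℂ} {a : n → ℝ} (hU : Uᴴ * U = 1)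
    (hA : A = U * realDiag a * Uᴴ) (t : ℝ) :
    matPow A t = U * realDiag (fun i => suppRpow t (a i)) * Uᴴ :=
  matFun_eq hU hA _

lemma suppRpow_nonneg (t : ℝ) {x : ℝ} (hx : 0 ≤ x) : 0 ≤ suppRpow t x := by
  unfold suppRpow; split_ifs
  · exact le_rfl
  · exact Real.rpow_nonneg hx t

lemma suppRpow_of_pos {t : ℝ} (ht : 0 < t) (x : ℝ) : suppRpow t x = x ^ t := by
  unfold suppRpow; split_ifs with h
  · rw [h, Real.zero_rpow ht.ne']
  · rfl

lemma conjTranspose_mul_self_mul {U V : Matrix n n ℂ} (hU : Uᴴ * U = 1) (hV : Vᴴ * V = 1) :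
    (U * V)ᴴ * (U * V) = 1 := by
  rw [conjTranspose_mul]
  calc Vᴴ * Uᴴ * (U * V) = Vᴴ * (Uᴴ * U) * V := by noncomm_ring
    _ = 1 := by rw [hU, Matrix.mul_one, hV]

lemma matPow_conj {M U : Matrix n n ℂ} (hU : Uᴴ * U = 1) (hM : M.IsHermitian) (t : ℝ) :
    matPow (U * M * Uᴴ) t = U * matPow M t * Uᴴ := by
  obtain ⟨V, a, hV, h⟩ := exists_unitary_realDiag hM
  have : U * M * Uᴴ = (U * V) * realDiag a * (U * V)ᴴ := by
    rw [h, conjTranspose_mul]; noncomm_ring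
  rw [matPow_eq (conjTranspose_mul_self_mul hU hV) this, matPow_eq hV h, conjTranspose_mul]
  noncomm_ring

/-- A Hermitian matrix can be diagonalized inside every block of equal values of `q` by a unitary
that is block diagonal with respect to `q`. -/
lemma exists_blockDiagonalizing_unitary (q : n → ℝ) {X : Matrix n n ℂ} (hX : X.IsHermitian) :
    ∃ W : Matrix n n ℂ, Wᴴ * W = 1 ∧ (∀ i j, q i ≠ q j → W i j = 0) ∧
      ∀ i j, i ≠ j → q i = q j → (Wᴴ * X * W) i j = 0 := by
  have hc : ∀ c : ℝ, ∃ (U : Matrix {i // q i = c} {i // q i = c} ℂ) (a : {i // q i = c} → ℝ),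
      Uᴴ * U = 1 ∧ X.submatrix Subtype.val Subtype.val = U * realDiag a * Uᴴ :=
    fun c => exists_unitary_realDiag (hX.submatrix _)
  choose U a hU ha using hc
  set W : Matrix n n ℂ := fun i j => if h : q i = q j then U (q j) ⟨i, h⟩ ⟨j, rfl⟩ else 0 with hW
  have hWe : ∀ (c : ℝ) (i j : {i // q i = c}), W i.1 j.1 = U c i j := by
    rintro c ⟨i, hi⟩ ⟨j, rfl⟩
    simp [hW, hi]
  have hW0 : ∀ i j, q i ≠ q j → W i j = 0 := fun i j h => by simp [hW, h]
  have hsum : ∀ (c : ℝ) (F : n → ℂ) , (∀ i, q i ≠ c → F i = 0) →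
      ∑ i, F i = ∑ i : {i // q i = c}, F i.1 := by
    intro c F hF
    rw [← Finset.sum_subtype (Finset.univ.filter fun i => q i = c) (by simp) F]
    exact (Finset.sum_filter_of_ne fun i _ hi => by
      by_contra h
      exact hi (hF i h)).symm
  refine ⟨W, ?_, hW0, ?_⟩
  · ext j k
    simp only [mul_apply, conjTranspose_apply]
    by_cases hjk : q j = q k
    · obtain ⟨c, hk⟩ : ∃ c, q k = c := ⟨_, rfl⟩
      rw [hsum c _ fun i hi => by rw [hW0 i k (by rwa [hk]), mul_zero]]
      have h1 := congrFun (congrFun (hU c) ⟨j, hjk.trans hk⟩) ⟨k, hk⟩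
      simp only [mul_apply, conjTranspose_apply, one_apply, Subtype.mk.injEq] at h1
      rw [one_apply, ← h1]
      exact Finset.sum_congr rfl fun i _ => by
        rw [← hWe c i ⟨j, hjk.trans hk⟩, ← hWe c i ⟨k, hk⟩]
    · have hne : j ≠ k := fun h => hjk (by rw [h])
      rw [one_apply_ne hne]
      refine Finset.sum_eq_zero fun i _ => ?_
      by_cases hij : q i = q j
      · rw [hW0 i k (by rwa [hij]), mul_zero]
      · rw [hW0 i j hij, star_zero, zero_mul]
  · intro j k hne hjk
    obtain ⟨c, hk⟩ : ∃ c, q k = c := ⟨_, rfl⟩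
    have hj : q j = c := hjk.trans hk
    have h1 : ((U c)ᴴ * X.submatrix Subtype.val Subtype.val * U c :
        Matrix {i // q i = c} {i // q i = c} ℂ) ⟨j, hj⟩ ⟨k, hk⟩ = 0 := by
      rw [conj_cancel (hU c) (ha c), realDiag, diagonal_apply_ne]
      simpa using hne
    rw [← h1]
    simp only [mul_apply, conjTranspose_apply, submatrix_apply]
    rw [hsum c _ fun i hi => by rw [hW0 i k (by rwa [hk]), mul_zero]]
    refine Finset.sum_congr rfl fun i _ => ?_
    rw [← hWe c i ⟨k, hk⟩]
    congr 1
    rw [hsum c _ fun l hl => by rw [hW0 l j (by rwa [hj]), star_zero, zero_mul]]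
    exact Finset.sum_congr rfl fun l _ => by rw [← hWe c l ⟨j, hj⟩]

end LinearAlgebra

section Pinching

open Matrix

variable {n : Type*} [Fintype n] [DecidableEq n]

lemma trace_mul_posSemidef_nonneg {A B : Matrix n n ℂ} (hA : A.PosSemidef) (hB : B.PosSemidef) :
    0 ≤ (A * B).trace.re := by
  obtain ⟨U, a, hU, h, ha⟩ := PosSemidef.exists_unitary_realDiag hA
  have h1 : (A * B).trace = (realDiag a * (Uᴴ * B * U)).trace := by
    rw [h, Matrix.mul_assoc, Matrix.mul_assoc, trace_mul_comm]
    noncomm_ring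
  rw [h1]
  simp only [trace, diag_apply, realDiag, diagonal_mul, Complex.re_sum]
  refine Finset.sum_nonneg fun i _ => ?_
  rw [Complex.re_ofReal_mul]
  exact mul_nonneg (ha i) (Complex.le_def.mp (posSemidef_conj hB U).diag_nonneg).1

/-- The pinching inequality in an adapted basis: if the diagonal blocks of `Y ≥ 0` with respect to
the level sets of `q` are diagonal, then `Y ≤ v • diag Y`, with `v` the number of level sets. -/
lemma pinching_le (q : n → ℝ) {Y : Matrix n n ℂ} (hY : Y.PosSemidef)
    (hoff : ∀ i j, i ≠ j → q i = q j → Y i j = 0) :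
    (realDiag (fun i => ((Finset.univ.image q).card : ℝ) * (Y i i).re) - Y).PosSemidef := by
  set S := Finset.univ.image q with hS
  set P : ℝ → Matrix n n ℂ := fun c => realDiag fun i => if q i = c then 1 else 0 with hP
  have hsum : (∑ k ∈ S, ∑ l ∈ S, (P k - P l)ᴴ * Y * (P k - P l)).PosSemidef :=
    posSemidef_sum _ fun k _ => posSemidef_sum _ fun l _ => posSemidef_conj hY _
  have hhalf : (realDiag (fun i => (S.card : ℝ) * (Y i i).re) - Y) =
      ((2 : ℝ)⁻¹) • (∑ k ∈ S, ∑ l ∈ S, (P k - P l)ᴴ * Y * (P k - P l)) := by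
    ext i j
    have hmem : ∀ i, q i ∈ S := fun i => Finset.mem_image_of_mem q (Finset.mem_univ i)
    have hPd : ∀ k l, P k - P l =
        realDiag fun i => (if q i = k then 1 else 0) - (if q i = l then 1 else 0) := by
      intro k l
      simp [hP, realDiag]
    have hentry : ∀ k l, ((P k - P l)ᴴ * Y * (P k - P l)) i j =
        (if q i = k then if q j = k then Y i j else 0 else 0)
        - (if q i = k then if q j = l then Y i j else 0 else 0)
        - (if q i = l then if q j = k then Y i j else 0 else 0)
        + (if q i = l then if q j = l then Y i j else 0 else 0) := by
      intro k l
      rw [hPd, realDiag_conjTranspose]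
      simp only [realDiag, diagonal_mul, mul_diagonal]
      split_ifs <;> simp
    simp only [Matrix.sub_apply, Matrix.smul_apply, Matrix.sum_apply, hentry, Finset.sum_add_distrib,
      Finset.sum_sub_distrib, Finset.sum_ite_eq, Finset.sum_const, hmem, if_true]
    by_cases hij : i = j
    · subst hij
      have hr : ((Y i i).re : ℂ) = Y i i := by
        have := (Complex.le_def.mp (hY.diag_nonneg (i := i))).2
        exact Complex.ext (by simp) (by simpa using this)
      simp [realDiag, hmem, hr]
      ring
    · rw [realDiag, diagonal_apply_ne _ hij]
      by_cases hq : q i = q j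
      · simp [hoff i j hij hq]
      · simp [hq, Ne.symm hq, hmem, eq_comm]
        ring
  rw [hhalf]
  exact hsum.smul (by norm_num)

end Pinching

section Sandwiched

open Matrix

variable {n : Type*} [Fintype n] [DecidableEq n]

/-- The real number `Tr (σ^{(1−α)/(2α)} ρ σ^{(1−α)/(2α)})^α`. -/
noncomputable def sandwichedTrace (α : ℝ) (ρ σ : Matrix n n ℂ) : ℝ :=
  (matPow (matPow σ ((1 - α) / (2 * α)) * ρ * matPow σ ((1 - α) / (2 * α))) α).trace.re

lemma sum_normSq_row {R : Matrix n n ℂ} (hR : Rᴴ * R = 1) (i : n) :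
    ∑ j, Complex.normSq (R i j) = 1 := by
  have h := congrFun (congrFun (mul_conjTranspose_eq_one hR) i) i
  simp only [mul_apply, conjTranspose_apply, one_apply_eq, RCLike.star_def,
    Complex.mul_conj] at h
  exact_mod_cast h

lemma sum_normSq_col {R : Matrix n n ℂ} (hR : Rᴴ * R = 1) (j : n) :
    ∑ i, Complex.normSq (R i j) = 1 := by
  have h := congrFun (congrFun hR j) j
  simp only [mul_apply, conjTranspose_apply, one_apply_eq, RCLike.star_def,
    ← Complex.normSq_eq_conj_mul_self] at h
  exact_mod_cast h

lemma conj_realDiag_diag_re (R : Matrix n n ℂ) (a : n → ℝ) (i : n) :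
    ((R * realDiag a * Rᴴ) i i).re = ∑ j, Complex.normSq (R i j) * a j := by
  rw [mul_apply, Complex.re_sum]
  refine Finset.sum_congr rfl fun j _ => ?_
  simp only [realDiag, mul_diagonal, conjTranspose_apply, RCLike.star_def]
  have : R i j * (a j : ℂ) * (starRingEnd ℂ) (R i j) =
      ((Complex.normSq (R i j) * a j : ℝ) : ℂ) := by
    rw [mul_right_comm, Complex.mul_conj]; push_cast; rfl
  rw [this, Complex.ofReal_re]

/-- Peierls' inequality for the power function. -/
lemma sum_conj_realDiag_rpow_le {R : Matrix n n ℂ} (hR : Rᴴ * R = 1) {a : n → ℝ}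
    (ha : ∀ i, 0 ≤ a i) {α : ℝ} (hα : 1 ≤ α) :
    ∑ i, (((R * realDiag a * Rᴴ) i i).re) ^ α ≤ ∑ j, a j ^ α := by
  calc ∑ i, (((R * realDiag a * Rᴴ) i i).re) ^ α
      ≤ ∑ i, ∑ j, Complex.normSq (R i j) * a j ^ α := by
        refine Finset.sum_le_sum fun i _ => ?_
        rw [conj_realDiag_diag_re]
        exact Real.rpow_arith_mean_le_arith_mean_rpow _ _ _
          (fun j _ => Complex.normSq_nonneg _) (sum_normSq_row hR i) (fun j _ => ha j) hα
    _ = ∑ j, a j ^ α := by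
        rw [Finset.sum_comm]
        refine Finset.sum_congr rfl fun j _ => ?_
        rw [← Finset.sum_mul, sum_normSq_col hR, one_mul]

lemma trace_matPow {M R : Matrix n n ℂ} {a : n → ℝ} (hR : Rᴴ * R = 1)
    (hM : M = R * realDiag a * Rᴴ) {α : ℝ} (hα : 0 < α) :
    (matPow M α).trace.re = ∑ j, a j ^ α := by
  rw [matPow_eq hR hM, trace_conj hR]
  simp [trace, realDiag, suppRpow_of_pos hα]

/-- The matrix `σ^{s} ρ σ^{s}` expressed in an eigenbasis `U` of `σ = U q Uᴴ`. -/
noncomputable def sandwich (s : ℝ) (q : n → ℝ) (X : Matrix n n ℂ) : Matrix n n ℂ :=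
  realDiag (fun i => suppRpow s (q i)) * X * realDiag (fun i => suppRpow s (q i))

lemma sandwich_apply (s : ℝ) (q : n → ℝ) (X : Matrix n n ℂ) (i j : n) :
    sandwich s q X i j = suppRpow s (q i) * X i j * suppRpow s (q j) := by
  simp [sandwich, realDiag]

lemma sandwich_diag_re (s : ℝ) (q : n → ℝ) (X : Matrix n n ℂ) (i : n) :
    (sandwich s q X i i).re = suppRpow s (q i) ^ 2 * (X i i).re := by
  rw [sandwich_apply, mul_right_comm, ← Complex.ofReal_mul, Complex.re_ofReal_mul, sq]

lemma sandwich_posSemidef (s : ℝ) (q : n → ℝ) {X : Matrix n n ℂ} (hX : X.PosSemidef) :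
    (sandwich s q X).PosSemidef := by
  have := posSemidef_conj hX (realDiag fun i => suppRpow s (q i))
  rwa [realDiag_conjTranspose] at this

lemma sandwichedTrace_eq {α : ℝ} {ρ σ U : Matrix n n ℂ} {q : n → ℝ} (hρ : ρ.PosSemidef)
    (hU : Uᴴ * U = 1) (hσ : σ = U * realDiag q * Uᴴ) :
    sandwichedTrace α ρ σ =
      (matPow (sandwich ((1 - α) / (2 * α)) q (Uᴴ * ρ * U)) α).trace.re := by
  unfold sandwichedTrace
  have : matPow σ ((1 - α) / (2 * α)) * ρ * matPow σ ((1 - α) / (2 * α)) =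
      U * sandwich ((1 - α) / (2 * α)) q (Uᴴ * ρ * U) * Uᴴ := by
    rw [matPow_eq hU hσ, sandwich]
    noncomm_ring
  rw [this, matPow_conj hU (sandwich_posSemidef _ _ (posSemidef_conj hρ U)).isHermitian,
    trace_conj hU]

lemma sum_sandwich_diag_le {α : ℝ} (hα : 1 < α) {ρ σ U : Matrix n n ℂ} {q : n → ℝ}
    (hρ : ρ.PosSemidef) (hU : Uᴴ * U = 1) (hσ : σ = U * realDiag q * Uᴴ) :
    ∑ i, (suppRpow ((1 - α) / (2 * α)) (q i) ^ 2 * ((Uᴴ * ρ * U) i i).re) ^ α ≤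
      sandwichedTrace α ρ σ := by
  rw [sandwichedTrace_eq hρ hU hσ]
  obtain ⟨R, a, hR, hM, ha⟩ := PosSemidef.exists_unitary_realDiag
    (sandwich_posSemidef ((1 - α) / (2 * α)) q (posSemidef_conj hρ U))
  rw [trace_matPow hR hM (by linarith)]
  refine le_trans (le_of_eq ?_) (sum_conj_realDiag_rpow_le hR ha hα.le)
  refine Finset.sum_congr rfl fun i _ => ?_
  rw [← hM, sandwich_diag_re]

lemma posSemidef_diag_re_nonneg {A : Matrix n n ℂ} (hA : A.PosSemidef) (i : n) :
    0 ≤ (A i i).re := (Complex.le_def.mp hA.diag_nonneg).1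

lemma sandwichedTrace_le_sum {α : ℝ} (hα : 1 < α) {ρ σ U : Matrix n n ℂ} {q : n → ℝ}
    (hρ : ρ.PosSemidef) (hU : Uᴴ * U = 1) (hσ : σ = U * realDiag q * Uᴴ)
    (hoff : ∀ i j, i ≠ j → q i = q j → (Uᴴ * ρ * U) i j = 0) :
    sandwichedTrace α ρ σ ≤ ((Finset.univ.image q).card : ℝ) ^ α *
      ∑ i, (suppRpow ((1 - α) / (2 * α)) (q i) ^ 2 * ((Uᴴ * ρ * U) i i).re) ^ α := by
  rw [sandwichedTrace_eq hρ hU hσ]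
  set M := sandwich ((1 - α) / (2 * α)) q (Uᴴ * ρ * U) with hMdef
  have hMpos : M.PosSemidef := sandwich_posSemidef _ q (posSemidef_conj hρ U)
  obtain ⟨R, a, hR, hM, ha⟩ := PosSemidef.exists_unitary_realDiag hMpos
  have hle := pinching_le q hMpos fun i j hij hq => by
    rw [hMdef, sandwich_apply, hoff i j hij hq, mul_zero, zero_mul]
  set v : ℝ := ((Finset.univ.image q).card : ℝ) with hv
  have hv0 : 0 ≤ v := Nat.cast_nonneg _
  set b : n → ℝ := fun i => v * (M i i).re with hb
  have hb0 : ∀ i, 0 ≤ b i := fun i => mul_nonneg hv0 (posSemidef_diag_re_nonneg hMpos i)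
  have hR' : (Rᴴ)ᴴ * Rᴴ = 1 := by
    rw [conjTranspose_conjTranspose]; exact mul_conjTranspose_eq_one hR
  have hab : ∀ i, a i ≤ ((Rᴴ * realDiag b * (Rᴴ)ᴴ) i i).re := by
    intro i
    have h1 := posSemidef_diag_re_nonneg (posSemidef_conj hle R) i
    rw [Matrix.mul_sub, Matrix.sub_mul, conj_cancel hR hM, Matrix.sub_apply, Complex.sub_re] at h1
    rw [conjTranspose_conjTranspose]
    have h2 : (realDiag a i i).re = a i := by simp [realDiag]
    linarith
  rw [trace_matPow hR hM (by linarith)]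
  calc ∑ i, a i ^ α ≤ ∑ i, (((Rᴴ * realDiag b * (Rᴴ)ᴴ) i i).re) ^ α :=
        Finset.sum_le_sum fun i _ => Real.rpow_le_rpow (ha i) (hab i) (by linarith)
    _ ≤ ∑ i, b i ^ α := sum_conj_realDiag_rpow_le hR' hb0 hα.le
    _ = _ := by
        rw [Finset.mul_sum]
        refine Finset.sum_congr rfl fun i _ => ?_
        rw [hb, ← sandwich_diag_re]
        exact Real.mul_rpow hv0 (posSemidef_diag_re_nonneg hMpos i)

/-- Any eigenbasis of `σ` can be changed, within the eigenspaces of `σ`, to one that diagonalizes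
the diagonal blocks of a given Hermitian matrix. -/
lemma exists_adapted_eigenbasis {σ U X : Matrix n n ℂ} {q : n → ℝ} (hU : Uᴴ * U = 1)
    (hσ : σ = U * realDiag q * Uᴴ) (hX : X.IsHermitian) :
    ∃ V : Matrix n n ℂ, Vᴴ * V = 1 ∧ σ = V * realDiag q * Vᴴ ∧
      ∀ i j, i ≠ j → q i = q j → (Vᴴ * X * V) i j = 0 := by
  obtain ⟨W, hW, hW0, hoff⟩ :=
    exists_blockDiagonalizing_unitary q (isHermitian_conjTranspose_mul_mul U hX)
  refine ⟨U * W, conjTranspose_mul_self_mul hU hW, ?_, ?_⟩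
  · have hcomm : W * realDiag q = realDiag q * W := by
      ext i j
      simp only [realDiag, diagonal_mul, mul_diagonal]
      by_cases h : q i = q j
      · rw [h, mul_comm]
      · rw [hW0 i j h, mul_zero, zero_mul]
    calc σ = U * realDiag q * (W * Wᴴ) * Uᴴ := by
          rw [mul_conjTranspose_eq_one hW, Matrix.mul_one, hσ]
      _ = U * (realDiag q * W) * Wᴴ * Uᴴ := by noncomm_ring
      _ = _ := by rw [← hcomm, conjTranspose_mul]; noncomm_ring
  · intro i j hij hq
    rw [conjTranspose_mul, ← hoff i j hij hq]
    noncomm_ring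

lemma trace_mul_conj {A B U : Matrix n n ℂ} (hU : Uᴴ * U = 1) :
    (A * B).trace = ((Uᴴ * A * U) * (Uᴴ * B * U)).trace := by
  have : (Uᴴ * A * U) * (Uᴴ * B * U) = Uᴴ * (A * B) * (Uᴴ)ᴴ := by
    calc (Uᴴ * A * U) * (Uᴴ * B * U) = Uᴴ * A * (U * Uᴴ) * B * U := by noncomm_ring
      _ = _ := by
        rw [mul_conjTranspose_eq_one hU, conjTranspose_conjTranspose, Matrix.mul_one]
        noncomm_ring
  rw [this, trace_conj (by rw [conjTranspose_conjTranspose]; exact mul_conjTranspose_eq_one hU)]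

lemma diag_eq_zero_of_supp {ρ σ U : Matrix n n ℂ} {q : n → ℝ} (hU : Uᴴ * U = 1)
    (hσ : σ = U * realDiag q * Uᴴ) (hs : ρ * matPow σ 0 = ρ) {i : n} (hi : q i = 0) :
    (Uᴴ * ρ * U) i i = 0 := by
  have h : Uᴴ * ρ * U = (Uᴴ * ρ * U) * realDiag fun i => suppRpow 0 (q i) := by
    conv_lhs => rw [← hs, matPow_eq hU hσ]
    calc Uᴴ * (ρ * (U * (realDiag fun i => suppRpow 0 (q i)) * Uᴴ)) * U
        = (Uᴴ * ρ * U) * (realDiag fun i => suppRpow 0 (q i)) * (Uᴴ * U) := by noncomm_ring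
      _ = _ := by rw [hU, Matrix.mul_one]
  rw [h, realDiag, mul_diagonal, suppRpow, if_pos hi]
  simp

lemma trace_mul_realDiag_re (A : Matrix n n ℂ) (t : n → ℝ) :
    (A * realDiag t).trace.re = ∑ i, (A i i).re * t i := by
  simp [trace, realDiag, mul_diagonal]

/-- The success probabilities of a test under `ρ` and `σ` are related by the sandwiched Rényi
quantity, up to the number of distinct eigenvalues of `σ`. -/
theorem trace_mul_test_le {α : ℝ} (hα : 1 < α) {ρ σ T U : Matrix n n ℂ} {q : n → ℝ}
    (hρ : ρ.PosSemidef) (hU : Uᴴ * U = 1) (hσ : σ = U * realDiag q * Uᴴ) (hq : ∀ i, 0 ≤ q i)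
    (hs : ρ * matPow σ 0 = ρ) (hT : IsTest T) :
    (ρ * T).trace.re ≤ ((Finset.univ.image q).card : ℝ) *
      (sandwichedTrace α ρ σ ^ (1 / α) * ((σ * T).trace.re) ^ ((α - 1) / α)) := by
  obtain ⟨V, hV, hσV, hoff⟩ := exists_adapted_eigenbasis hU hσ hT.1.isHermitian
  set T' := Vᴴ * T * V with hT'
  set ρ' := Vᴴ * ρ * V with hρ'
  set t : n → ℝ := fun i => (T' i i).re with ht
  set p : n → ℝ := fun i => (ρ' i i).re with hp
  have hT'pos : T'.PosSemidef := posSemidef_conj hT.1 V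
  have hρ'pos : ρ'.PosSemidef := posSemidef_conj hρ V
  have ht0 : ∀ i, 0 ≤ t i := posSemidef_diag_re_nonneg hT'pos
  have hp0 : ∀ i, 0 ≤ p i := posSemidef_diag_re_nonneg hρ'pos
  have ht1 : ∀ i, t i ≤ 1 := by
    intro i
    have h := posSemidef_diag_re_nonneg (posSemidef_conj hT.2 V) i
    rw [Matrix.mul_sub, Matrix.sub_mul, Matrix.mul_one, hV, Matrix.sub_apply, Complex.sub_re,
      one_apply_eq, Complex.one_re] at h
    simp only [ht, hT']
    linarith
  set v : ℝ := ((Finset.univ.image q).card : ℝ) with hv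
  have hσT : (σ * T).trace.re = ∑ i, q i * t i := by
    rw [trace_mul_conj hV, conj_cancel hV hσV, trace_mul_comm, trace_mul_realDiag_re]
    exact Finset.sum_congr rfl fun i _ => mul_comm _ _
  have hρT : (ρ * T).trace.re ≤ v * ∑ i, p i * t i := by
    have h := trace_mul_posSemidef_nonneg hρ'pos (pinching_le q hT'pos hoff)
    rw [Matrix.mul_sub, trace_sub, Complex.sub_re, trace_mul_realDiag_re] at h
    rw [trace_mul_conj hV, Finset.mul_sum]
    have e : ∑ i, v * (p i * t i) = ∑ i, (ρ' i i).re * (v * (T' i i).re) :=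
      Finset.sum_congr rfl fun i _ => by simp only [hp, ht]; ring
    rw [e]
    linarith
  have hα0 : 0 < α := by linarith
  set u : ℝ := (α - 1) / α with hu
  have hu0 : 0 < u := div_pos (by linarith) hα0
  have hconj : α.HolderConjugate u⁻¹ := by
    rw [Real.holderConjugate_iff]
    refine ⟨hα, ?_⟩
    rw [hu, inv_inv]; field_simp; ring
  set g : n → ℝ := fun i => suppRpow ((1 - α) / (2 * α)) (q i) ^ 2 with hg
  have hfac : ∀ i, p i * t i = (g i * p i) * (q i ^ u * t i) := by
    intro i
    rcases (hq i).eq_or_lt with h0 | h0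
    · have : p i = 0 := by
        simp only [hp, hρ']
        rw [diag_eq_zero_of_supp hV hσV hs h0.symm, Complex.zero_re]
      simp [this]
    · have : g i * q i ^ u = 1 := by
        simp only [hg, suppRpow, if_neg h0.ne']
        rw [← Real.rpow_natCast, ← Real.rpow_mul h0.le, ← Real.rpow_add h0]
        have : (1 - α) / (2 * α) * ((2 : ℕ) : ℝ) + u = 0 := by
          rw [hu]; push_cast; field_simp; ring
        rw [this, Real.rpow_zero]
      calc p i * t i = (g i * q i ^ u) * (p i * t i) := by rw [this, one_mul]
        _ = _ := by ring
  refine hρT.trans (mul_le_mul_of_nonneg_left ?_ (Nat.cast_nonneg _))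
  have hA0 : ∀ i, 0 ≤ g i * p i := fun i => mul_nonneg (sq_nonneg _) (hp0 i)
  have hB0 : ∀ i, 0 ≤ q i ^ u * t i := fun i => mul_nonneg (Real.rpow_nonneg (hq i) _) (ht0 i)
  calc ∑ i, p i * t i = ∑ i, (g i * p i) * (q i ^ u * t i) :=
        Finset.sum_congr rfl fun i _ => hfac i
    _ ≤ (∑ i, (g i * p i) ^ α) ^ (1 / α) * (∑ i, (q i ^ u * t i) ^ u⁻¹) ^ (1 / u⁻¹) :=
        Real.inner_le_Lp_mul_Lq_of_nonneg _ hconj (fun i _ => hA0 i) (fun i _ => hB0 i)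
    _ ≤ _ := by
        rw [one_div u⁻¹, inv_inv, hσT]
        refine mul_le_mul ?_ ?_ (Real.rpow_nonneg (Finset.sum_nonneg fun i _ =>
          Real.rpow_nonneg (hB0 i) _) _) (Real.rpow_nonneg ?_ _)
        · exact Real.rpow_le_rpow (Finset.sum_nonneg fun i _ => Real.rpow_nonneg (hA0 i) _)
            (sum_sandwich_diag_le hα hρ hV hσV) (by positivity)
        · refine Real.rpow_le_rpow (Finset.sum_nonneg fun i _ => Real.rpow_nonneg (hB0 i) _)
            (Finset.sum_le_sum fun i _ => ?_) hu0.le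
          rw [Real.mul_rpow (Real.rpow_nonneg (hq i) _) (ht0 i), ← Real.rpow_mul (hq i),
            mul_inv_cancel₀ hu0.ne', Real.rpow_one]
          refine mul_le_mul_of_nonneg_left ?_ (hq i)
          calc t i ^ u⁻¹ ≤ t i ^ (1 : ℝ) :=
                Real.rpow_le_rpow_of_exponent_ge' (ht0 i) (ht1 i) zero_le_one
                  hconj.symm.lt.le
            _ = t i := Real.rpow_one _
        · exact (Finset.sum_nonneg fun i _ => Real.rpow_nonneg (hA0 i) _).trans
            (sum_sandwich_diag_le hα hρ hV hσV)

end Sandwiched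

section TensorPower

open Matrix

variable {ι X : Type*} [Fintype ι] [DecidableEq ι] [Fintype X] [DecidableEq X]

/-- The tensor power of a matrix, with factors indexed by `ι`. -/
noncomputable def tpow (ι : Type*) [Fintype ι] (A : Matrix X X ℂ) :
    Matrix (ι → X) (ι → X) ℂ := Matrix.of fun x y => ∏ i, A (x i) (y i)

lemma tpow_apply (A : Matrix X X ℂ) (x y : ι → X) : tpow ι A x y = ∏ i, A (x i) (y i) := rfl

lemma tpow_mul (A B : Matrix X X ℂ) : tpow ι (A * B) = tpow ι A * tpow ι B := by
  ext x y
  simp only [tpow_apply, mul_apply, ← Finset.prod_mul_distrib]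
  exact Fintype.prod_sum fun i k => A (x i) k * B k (y i)

lemma tpow_conjTranspose (A : Matrix X X ℂ) : tpow ι Aᴴ = (tpow ι A)ᴴ := by
  ext x y
  simp [tpow_apply, conjTranspose_apply]

lemma tpow_realDiag (a : X → ℝ) :
    tpow ι (realDiag a) = realDiag fun x : ι → X => ∏ i, a (x i) := by
  ext x y
  by_cases h : x = y
  · subst h; simp [tpow_apply, realDiag]
  · obtain ⟨i, hi⟩ := Function.ne_iff.mp h
    have hr : (realDiag fun x : ι → X => ∏ i, a (x i)) x y = 0 := by
      rw [realDiag, diagonal_apply_ne _ h]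
    rw [hr, tpow_apply]
    exact Finset.prod_eq_zero (Finset.mem_univ i) (by rw [realDiag, diagonal_apply_ne _ hi])

lemma tpow_one : tpow ι (1 : Matrix X X ℂ) = 1 := by
  have h := tpow_realDiag (ι := ι) fun _ : X => (1 : ℝ)
  simpa [realDiag] using h

lemma trace_tpow (A : Matrix X X ℂ) : (tpow ι A).trace = A.trace ^ Fintype.card ι := by
  have := Fintype.prod_sum fun (_ : ι) k => A k k
  simp only [trace, diag_apply, tpow_apply, ← this, Finset.prod_const, Finset.card_univ]

lemma tpow_unitary {U : Matrix X X ℂ} (hU : Uᴴ * U = 1) : (tpow ι U)ᴴ * tpow ι U = 1 := by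
  rw [← tpow_conjTranspose, ← tpow_mul, hU, tpow_one]

lemma tpow_spectral {A U : Matrix X X ℂ} {a : X → ℝ} (hA : A = U * realDiag a * Uᴴ) :
    tpow ι A = tpow ι U * realDiag (fun x : ι → X => ∏ i, a (x i)) * (tpow ι U)ᴴ := by
  rw [hA, tpow_mul, tpow_mul, tpow_realDiag, tpow_conjTranspose]

lemma posSemidef_conj_realDiag (U : Matrix X X ℂ) {a : X → ℝ} (ha : ∀ i, 0 ≤ a i) :
    (U * realDiag a * Uᴴ).PosSemidef := by
  have : (realDiag a).PosSemidef := by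
    rw [realDiag, posSemidef_diagonal_iff]
    exact fun i => by exact_mod_cast ha i
  exact this.mul_mul_conjTranspose_same U

lemma tpow_posSemidef {A : Matrix X X ℂ} (hA : A.PosSemidef) : (tpow ι A).PosSemidef := by
  obtain ⟨U, a, -, h, ha⟩ := PosSemidef.exists_unitary_realDiag hA
  rw [tpow_spectral h]
  exact posSemidef_conj_realDiag _ fun x => Finset.prod_nonneg fun i _ => ha _

lemma suppRpow_prod (t : ℝ) {a : ι → ℝ} (ha : ∀ i, 0 ≤ a i) :
    suppRpow t (∏ i, a i) = ∏ i, suppRpow t (a i) := by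
  by_cases h : ∃ i, a i = 0
  · obtain ⟨i, hi⟩ := h
    rw [Finset.prod_eq_zero (Finset.mem_univ i) hi,
      Finset.prod_eq_zero (i := i) (Finset.mem_univ i) (by simp [suppRpow, hi])]
    simp [suppRpow]
  · push Not at h
    rw [suppRpow, if_neg (Finset.prod_ne_zero_iff.mpr fun i _ => h i),
      ← Real.finsetProd_rpow _ _ fun i _ => ha i]
    exact Finset.prod_congr rfl fun i _ => by rw [suppRpow, if_neg (h i)]

lemma matPow_tpow {A : Matrix X X ℂ} (hA : A.PosSemidef) (t : ℝ) :
    matPow (tpow ι A) t = tpow ι (matPow A t) := by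
  obtain ⟨U, a, hU, h, ha⟩ := PosSemidef.exists_unitary_realDiag hA
  rw [matPow_eq (tpow_unitary hU) (tpow_spectral h), matPow_eq hU h, tpow_spectral rfl]
  simp only [suppRpow_prod t fun _ => ha _]

lemma matPow_posSemidef {A : Matrix X X ℂ} (hA : A.PosSemidef) (t : ℝ) :
    (matPow A t).PosSemidef := by
  obtain ⟨U, a, hU, h, ha⟩ := PosSemidef.exists_unitary_realDiag hA
  rw [matPow_eq hU h]
  exact posSemidef_conj_realDiag _ fun i => suppRpow_nonneg t (ha i)

lemma sandwichedTrace_tpow {ρ σ : Matrix X X ℂ} (hρ : ρ.PosSemidef) (hσ : σ.PosSemidef) (α : ℝ) :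
    sandwichedTrace α (tpow ι ρ) (tpow ι σ) = sandwichedTrace α ρ σ ^ Fintype.card ι := by
  have hM : (matPow σ ((1 - α) / (2 * α)) * ρ * matPow σ ((1 - α) / (2 * α))).PosSemidef := by
    have := posSemidef_conj hρ (matPow σ ((1 - α) / (2 * α)))
    rwa [(matPow_posSemidef hσ _).isHermitian.eq] at this
  unfold sandwichedTrace
  rw [matPow_tpow hσ, ← tpow_mul, ← tpow_mul, matPow_tpow hM, trace_tpow]
  have him : (matPow (matPow σ ((1 - α) / (2 * α)) * ρ * matPow σ ((1 - α) / (2 * α))) α).trace.im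
      = 0 := by
    rw [trace, Complex.im_sum]
    exact Finset.sum_eq_zero fun i _ =>
      (Complex.le_def.mp (matPow_posSemidef hM α).diag_nonneg).2.symm
  generalize (matPow (matPow σ ((1 - α) / (2 * α)) * ρ * matPow σ ((1 - α) / (2 * α))) α).trace = z
    at him
  have hz : z = (z.re : ℂ) := Complex.ext rfl (by simpa using him)
  rw [hz, ← Complex.ofReal_pow, Complex.ofReal_re, Complex.ofReal_re]

lemma tpow_mul_matPow_zero {ρ σ : Matrix X X ℂ} (hσ : σ.PosSemidef)
    (hs : ρ * matPow σ 0 = ρ) : tpow ι ρ * matPow (tpow ι σ) 0 = tpow ι ρ := by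
  rw [matPow_tpow hσ, ← tpow_mul, hs]

lemma mul_matPow_zero_of_suppLE {ρ σ : Matrix X X ℂ} (hσ : σ.IsHermitian) (h : suppLE ρ σ) :
    ρ * matPow σ 0 = ρ := by
  obtain ⟨U, a, hU, ha⟩ := exists_unitary_realDiag hσ
  have h0 : σ * (1 - matPow σ 0) = 0 := by
    rw [matPow_eq hU ha, Matrix.mul_sub, Matrix.mul_one, sub_eq_zero]
    conv_lhs => rw [ha]
    conv_rhs => rw [ha]
    have e : realDiag a = realDiag a * realDiag fun i => suppRpow 0 (a i) := by
      rw [realDiag_mul]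
      congr 1; ext i
      unfold suppRpow
      split_ifs with hi
      · simp [hi]
      · simp
    calc U * realDiag a * Uᴴ = U * (realDiag a * realDiag fun i => suppRpow 0 (a i)) * Uᴴ := by
          rw [← e]
      _ = U * realDiag a * (Uᴴ * U) * realDiag (fun i => suppRpow 0 (a i)) * Uᴴ := by
          rw [hU, Matrix.mul_one]; noncomm_ring
      _ = _ := by noncomm_ring
  have h1 : ρ * (1 - matPow σ 0) = 0 := by
    ext i j
    have hk : (1 - matPow σ 0).col j ∈ LinearMap.ker σ.mulVecLin := by
      rw [LinearMap.mem_ker, mulVecLin_apply]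
      ext k
      have := congrFun (congrFun h0 k) j
      simpa [mul_apply, mulVec, dotProduct] using this
    have := h hk
    rw [LinearMap.mem_ker, mulVecLin_apply] at this
    have := congrFun this i
    simpa [mul_apply, mulVec, dotProduct] using this
  rw [Matrix.mul_sub, Matrix.mul_one, sub_eq_zero] at h1
  exact h1.symm

/-- The number of distinct eigenvalues of a tensor power grows polynomially. -/
lemma card_image_prod_le (a : X → ℝ) :
    (Finset.univ.image fun x : ι → X => ∏ i, a (x i)).card ≤
      (Fintype.card ι + 1) ^ Fintype.card X := by
  set f : (ι → X) → X → Fin (Fintype.card ι + 1) := fun x c =>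
    ⟨(Finset.univ.filter fun i => x i = c).card, Nat.lt_succ_of_le (Finset.card_le_univ _)⟩ with hf
  have hprod : (fun x : ι → X => ∏ i, a (x i)) = (fun k => ∏ c, a c ^ (k c : ℕ)) ∘ f := by
    ext x
    simp only [Function.comp, hf]
    rw [← Finset.prod_fiberwise (s := Finset.univ) (g := x) (f := fun i => a (x i))]
    refine Finset.prod_congr rfl fun c _ => ?_
    rw [Finset.prod_congr rfl fun i hi => by rw [(Finset.mem_filter.mp hi).2],
      Finset.prod_const]
  rw [hprod, ← Finset.image_image]
  refine Finset.card_image_le.trans ((Finset.card_le_univ _).trans ?_)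
  simp

/-- Regrouping `N * m` tensor factors into `N` blocks of `m`. -/
def blockEquiv (X : Type*) (N m : ℕ) : (Fin (N * m) → X) ≃ (Fin N → Fin m → X) :=
  (Equiv.arrowCongr finProdFinEquiv.symm (Equiv.refl X)).trans (Equiv.curry _ _ _)

lemma tpow_block (A : Matrix X X ℂ) (N m : ℕ) :
    tpow (Fin (N * m)) A =
      (tpow (Fin N) (tpow (Fin m) A)).submatrix (blockEquiv X N m) (blockEquiv X N m) := by
  ext x y
  simp only [tpow_apply, submatrix_apply]
  rw [← Fintype.prod_prod_type', ← finProdFinEquiv.prod_comp]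
  rfl

end TensorPower

section Classical

open Filter Topology

variable {X : Type*} [Fintype X]

lemma sum_prod_eq_pow (N : ℕ) (w : X → ℝ) :
    ∑ x : Fin N → X, ∏ i, w (x i) = (∑ k, w k) ^ N := by
  have := Fintype.prod_sum fun (_ : Fin N) k => w k
  simpa using this.symm

/-- An exponential (Chernoff) bound on the probability that a sum of i.i.d. variables of negative
mean is nonnegative. -/
lemma exists_tail_bound {w a : X → ℝ} (hw : ∀ k, 0 ≤ w k) (hw1 : ∑ k, w k = 1)
    (ha : ∑ k, w k * a k < 0) :
    ∃ θ : ℝ, 0 ≤ θ ∧ θ < 1 ∧ ∀ N : ℕ,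
      ∑ x : Fin N → X, (if 0 ≤ ∑ i, a (x i) then ∏ i, w (x i) else 0) ≤ θ ^ N := by
  set g : ℝ → ℝ := fun s => ∑ k, w k * Real.exp (s * a k) with hg
  have hd : HasDerivAt g (∑ k, w k * a k) 0 := by
    have : ∀ k ∈ Finset.univ, HasDerivAt (fun s => w k * Real.exp (s * a k)) (w k * a k) 0 := by
      intro k _
      have h := (((hasDerivAt_id (0 : ℝ)).mul_const (a k)).exp).const_mul (w k)
      simpa using h
    exact HasDerivAt.fun_sum this
  have hslope := hasDerivAt_iff_tendsto_slope.mp hd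
  have hev : ∀ᶠ s in 𝓝[>] (0 : ℝ), slope g 0 s < 0 :=
    (hslope.mono_left (nhdsWithin_mono _ fun s (hs : 0 < s) => hs.ne')).eventually_lt_const ha
  obtain ⟨s, hs, hs0⟩ := (hev.and self_mem_nhdsWithin).exists
  have hs0 : 0 < s := hs0
  have hg0 : g 0 = 1 := by simp [hg, hw1]
  have hgs : g s < 1 := by
    rw [slope_def_field, hg0, sub_zero] at hs
    have := (div_neg_iff.mp hs).resolve_left fun h => absurd h.2 (by linarith)
    linarith [this.1]
  refine ⟨g s, Finset.sum_nonneg fun k _ => mul_nonneg (hw k) (Real.exp_pos _).le, hgs, fun N => ?_⟩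
  rw [← sum_prod_eq_pow]
  refine Finset.sum_le_sum fun x _ => ?_
  have hP : 0 ≤ ∏ i, w (x i) := Finset.prod_nonneg fun i _ => hw _
  rw [Finset.prod_mul_distrib, ← Real.exp_sum, ← Finset.mul_sum]
  split_ifs with h
  · exact le_mul_of_one_le_right hP (Real.one_le_exp (mul_nonneg hs0.le h))
  · exact mul_nonneg hP (Real.exp_pos _).le

/-- The weak law of large numbers on a finite alphabet. -/
lemma eventually_typical {w f : X → ℝ} (hw : ∀ k, 0 ≤ w k) (hw1 : ∑ k, w k = 1) {δ : ℝ}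
    (hδ : 0 < δ) : ∀ᶠ N : ℕ in atTop,
      1 / 2 ≤ ∑ x : Fin N → X,
        (if |∑ i, f (x i) - N * ∑ k, w k * f k| ≤ N * δ then ∏ i, w (x i) else 0) := by
  set E := ∑ k, w k * f k with hE
  have h1 : ∑ k, w k * (f k - E - δ) < 0 := by
    have : ∑ k, w k * (f k - E - δ) = E - (∑ k, w k) * (E + δ) := by
      rw [hE, Finset.sum_mul, ← Finset.sum_sub_distrib]
      exact Finset.sum_congr rfl fun k _ => by ring
    rw [this, hw1]; linarith
  have h2 : ∑ k, w k * (E - f k - δ) < 0 := by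
    have : ∑ k, w k * (E - f k - δ) = (∑ k, w k) * (E - δ) - E := by
      conv_rhs => rw [hE]
      rw [Finset.sum_mul, ← Finset.sum_sub_distrib]
      exact Finset.sum_congr rfl fun k _ => by ring
    rw [this, hw1]; linarith
  obtain ⟨θ₁, h10, h11, hθ₁⟩ := exists_tail_bound hw hw1 h1
  obtain ⟨θ₂, h20, h21, hθ₂⟩ := exists_tail_bound hw hw1 h2
  have e1 := (tendsto_pow_atTop_nhds_zero_of_lt_one h10 h11).eventually_lt_const
    (show (0 : ℝ) < 1 / 4 by norm_num)
  have e2 := (tendsto_pow_atTop_nhds_zero_of_lt_one h20 h21).eventually_lt_const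
    (show (0 : ℝ) < 1 / 4 by norm_num)
  filter_upwards [e1, e2] with N hN1 hN2
  have hsplit : ∑ x : Fin N → X, ∏ i, w (x i) ≤
      ∑ x : Fin N → X, (if |∑ i, f (x i) - N * E| ≤ N * δ then ∏ i, w (x i) else 0)
      + ∑ x : Fin N → X, (if 0 ≤ ∑ i, (f (x i) - E - δ) then ∏ i, w (x i) else 0)
      + ∑ x : Fin N → X, (if 0 ≤ ∑ i, (E - f (x i) - δ) then ∏ i, w (x i) else 0) := by
    rw [← Finset.sum_add_distrib, ← Finset.sum_add_distrib]
    refine Finset.sum_le_sum fun x _ => ?_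
    have hP : 0 ≤ ∏ i, w (x i) := Finset.prod_nonneg fun i _ => hw _
    have s1 : ∑ i, (f (x i) - E - δ) = ∑ i, f (x i) - N * E - N * δ := by
      simp [Finset.sum_sub_distrib]
    have s2 : ∑ i, (E - f (x i) - δ) = N * E - ∑ i, f (x i) - N * δ := by
      simp [Finset.sum_sub_distrib]
    rw [s1, s2]
    by_cases ha : |∑ i, f (x i) - N * E| ≤ N * δ
    · rw [if_pos ha]
      have : ∀ (P : Prop) [Decidable P], 0 ≤ if P then ∏ i, w (x i) else 0 := by
        intro P _; split_ifs <;> simp [hP]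
      linarith [this (0 ≤ ∑ i, f (x i) - N * E - N * δ), this (0 ≤ N * E - ∑ i, f (x i) - N * δ)]
    · rw [if_neg ha]
      rcases lt_abs.mp (not_le.mp ha) with h | h
      · rw [if_pos (show 0 ≤ ∑ i, f (x i) - N * E - N * δ by linarith)]
        split_ifs <;> linarith
      · rw [if_pos (show 0 ≤ N * E - ∑ i, f (x i) - N * δ by linarith)]
        split_ifs <;> linarith
  rw [sum_prod_eq_pow, hw1, one_pow] at hsplit
  have := hθ₁ N
  have := hθ₂ N
  linarith

/-- The moment generating function of `f` with respect to the weights `c`. -/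
noncomputable def mgfSum (c f : X → ℝ) (α : ℝ) : ℝ := ∑ k, c k * Real.exp (α * f k)

/-- The mean of `f` under the exponentially tilted weights `c k * exp (α * f k)`. -/
noncomputable def tiltedMean (c f : X → ℝ) (α : ℝ) : ℝ :=
  ∑ k, c k * Real.exp (α * f k) / mgfSum c f α * f k

variable {c f : X → ℝ}

lemma mgfSum_pos (hc : ∀ k, 0 ≤ c k) (hp : ∑ k, c k * Real.exp (f k) = 1) (α : ℝ) :
    0 < mgfSum c f α := by
  obtain ⟨k, hk⟩ : ∃ k, 0 < c k := by
    by_contra! h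
    have : ∀ k, c k = 0 := fun k => le_antisymm (h k) (hc k)
    simp [this] at hp
  exact Finset.sum_pos' (fun k _ => mul_nonneg (hc k) (Real.exp_pos _).le)
    ⟨k, Finset.mem_univ k, mul_pos hk (Real.exp_pos _)⟩

lemma continuous_mgfSum : Continuous (mgfSum c f) := by
  unfold mgfSum; fun_prop

lemma continuous_tiltedMean (hc : ∀ k, 0 ≤ c k) (hp : ∑ k, c k * Real.exp (f k) = 1) :
    Continuous (tiltedMean c f) := by
  unfold tiltedMean
  refine continuous_finsetSum _ fun k _ => ?_
  refine Continuous.mul (Continuous.div (by fun_prop) continuous_mgfSum fun α =>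
    (mgfSum_pos hc hp α).ne') continuous_const

/-- Nonnegativity of the relative entropy of the tilted distribution. -/
lemma tilted_relEntropy_nonneg (hc : ∀ k, 0 ≤ c k) (hc1 : ∑ k, c k ≤ 1)
    (hp : ∑ k, c k * Real.exp (f k) = 1) (α : ℝ) :
    0 ≤ α * tiltedMean c f α - Real.log (mgfSum c f α) := by
  have hZ := mgfSum_pos hc hp α
  set Z := mgfSum c f α with hZdef
  have hw1 : ∑ k, c k * Real.exp (α * f k) / Z = 1 := by
    rw [← Finset.sum_div]; exact div_self hZ.ne'
  have hexp : ∀ k, c k * Real.exp (α * f k) / Z = c k * Real.exp (α * f k - Real.log Z) := by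
    intro k
    rw [Real.exp_sub, Real.exp_log hZ, mul_div_assoc]
  have e : α * tiltedMean c f α - Real.log Z =
      ∑ k, c k * (Real.exp (α * f k - Real.log Z) * (α * f k - Real.log Z)) := by
    calc α * tiltedMean c f α - Real.log Z
        = α * tiltedMean c f α - (∑ k, c k * Real.exp (α * f k) / Z) * Real.log Z := by
          rw [hw1, one_mul]
      _ = ∑ k, (c k * Real.exp (α * f k) / Z) * (α * f k - Real.log Z) := by
          rw [tiltedMean, Finset.mul_sum, Finset.sum_mul, ← Finset.sum_sub_distrib]
          exact Finset.sum_congr rfl fun k _ => by ring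
      _ = _ := Finset.sum_congr rfl fun k _ => by rw [hexp, mul_assoc]
  have hle : ∑ k, c k * (Real.exp (α * f k - Real.log Z) - 1) ≤
      ∑ k, c k * (Real.exp (α * f k - Real.log Z) * (α * f k - Real.log Z)) := by
    refine Finset.sum_le_sum fun k _ => mul_le_mul_of_nonneg_left ?_ (hc k)
    generalize α * f k - Real.log Z = y
    have h1 := Real.add_one_le_exp (-y)
    have h2 : Real.exp y * Real.exp (-y) = 1 := by rw [← Real.exp_add]; simp
    nlinarith [Real.exp_pos y]
  have hsum : ∑ k, c k * (Real.exp (α * f k - Real.log Z) - 1) = 1 - ∑ k, c k := by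
    simp only [mul_sub, mul_one, Finset.sum_sub_distrib, ← hexp, hw1]
  rw [e]
  linarith

/-- Tests concentrated on sequences that are typical for the tilted distribution. -/
lemma eventually_exists_tilted_test (hc : ∀ k, 0 ≤ c k)
    (hp : ∑ k, c k * Real.exp (f k) = 1) {α δ κ r : ℝ} (hα : 1 ≤ α) (hδ : 0 < δ) (hκ : 0 ≤ κ)
    (hr : r ≤ α * (tiltedMean c f α - δ) - Real.log (mgfSum c f α) + κ) :
    ∀ᶠ N : ℕ in atTop, ∃ t : (Fin N → X) → ℝ, (∀ x, 0 ≤ t x) ∧ (∀ x, t x ≤ 1) ∧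
      ∑ x, t x * ∏ i, c (x i) ≤ Real.exp (-(N * r)) ∧
      1 / 2 * Real.exp (-(N * ((α - 1) * (tiltedMean c f α + δ) - Real.log (mgfSum c f α) + κ))) ≤
        ∑ x, t x * ∏ i, (c (x i) * Real.exp (f (x i))) := by
  have hZ := mgfSum_pos hc hp α
  set w : X → ℝ := fun k => c k * Real.exp (α * f k) / mgfSum c f α with hw
  have hw0 : ∀ k, 0 ≤ w k := fun k => div_nonneg (mul_nonneg (hc k) (Real.exp_pos _).le) hZ.le
  have hw1 : ∑ k, w k = 1 := by rw [hw, ← Finset.sum_div]; exact div_self hZ.ne'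
  filter_upwards [eventually_typical (f := f) hw0 hw1 hδ] with N hN
  set E := tiltedMean c f α with hE
  have hEw : ∑ k, w k * f k = E := rfl
  rw [hEw] at hN
  set L := Real.log (mgfSum c f α) with hL
  have hwc : ∀ k, c k = w k * Real.exp (L - α * f k) := by
    intro k
    simp only [hw]
    rw [Real.exp_sub, hL, Real.exp_log hZ]
    field_simp
  have hprodc : ∀ x : Fin N → X, ∏ i, c (x i) =
      (∏ i, w (x i)) * Real.exp (N * L - α * ∑ i, f (x i)) := by
    intro x
    rw [Finset.prod_congr rfl fun i _ => hwc (x i), Finset.prod_mul_distrib, ← Real.exp_sum]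
    simp [Finset.sum_sub_distrib, Finset.mul_sum]
  have hprodp : ∀ x : Fin N → X, ∏ i, (c (x i) * Real.exp (f (x i))) =
      (∏ i, w (x i)) * Real.exp (N * L - (α - 1) * ∑ i, f (x i)) := by
    intro x
    rw [Finset.prod_mul_distrib, hprodc, ← Real.exp_sum, mul_assoc, ← Real.exp_add]
    congr 2; ring
  have hP : ∀ x : Fin N → X, 0 ≤ ∏ i, w (x i) := fun x => Finset.prod_nonneg fun i _ => hw0 _
  have hN0 : (0 : ℝ) ≤ N := Nat.cast_nonneg N
  refine ⟨fun x => if |∑ i, f (x i) - N * E| ≤ N * δ then Real.exp (-(N * κ)) else 0,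
    fun x => ?_, fun x => ?_, ?_, ?_⟩
  · dsimp only; split_ifs
    · exact (Real.exp_pos _).le
    · exact le_rfl
  · dsimp only; split_ifs
    · rw [Real.exp_le_one_iff]; nlinarith
    · exact zero_le_one
  · calc _ ≤ ∑ x : Fin N → X, (∏ i, w (x i)) * Real.exp (-(N * r)) := by
          refine Finset.sum_le_sum fun x _ => ?_
          dsimp only
          split_ifs with h
          · rw [hprodc, mul_left_comm, ← Real.exp_add]
            refine mul_le_mul_of_nonneg_left (Real.exp_le_exp.mpr ?_) (hP x)
            have h1 := (abs_le.mp h).1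
            have h2 : α * (N * (E - δ)) ≤ α * ∑ i, f (x i) :=
              mul_le_mul_of_nonneg_left (by linarith) (by linarith)
            have h3 := mul_le_mul_of_nonneg_left hr hN0
            linarith
          · rw [zero_mul]
            exact mul_nonneg (hP x) (Real.exp_pos _).le
      _ = Real.exp (-(N * r)) := by
          rw [← Finset.sum_mul, sum_prod_eq_pow, hw1, one_pow, one_mul]
  · refine (mul_le_mul_of_nonneg_right hN (Real.exp_pos _).le).trans ?_
    rw [Finset.sum_mul]
    refine Finset.sum_le_sum fun x _ => ?_
    dsimp only
    split_ifs with h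
    · rw [hprodp, mul_left_comm, ← Real.exp_add]
      refine mul_le_mul_of_nonneg_left (Real.exp_le_exp.mpr ?_) (hP x)
      have h1 := (abs_le.mp h).2
      have h2 : (α - 1) * ∑ i, f (x i) ≤ (α - 1) * (N * (E + δ)) :=
        mul_le_mul_of_nonneg_left (by linarith) (by linarith)
      linarith
    · simp

/-- The choice of the tilting parameter that attains the Legendre-type bound `h`. -/
lemma exists_tilting_parameter (hc : ∀ k, 0 ≤ c k) (hc1 : ∑ k, c k ≤ 1)
    (hp : ∑ k, c k * Real.exp (f k) = 1) {r h : ℝ}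
    (hh : ∀ α, 1 < α → (α - 1) * r - Real.log (mgfSum c f α) ≤ α * h) {ε : ℝ} (hε : 0 < ε) :
    ∃ α, 1 ≤ α ∧ (α - 1) * tiltedMean c f α - Real.log (mgfSum c f α) +
      max (r - (α * tiltedMean c f α - Real.log (mgfSum c f α))) 0 ≤ h + ε := by
  have hcl : Continuous fun α => Real.log (mgfSum c f α) :=
    continuous_mgfSum.log fun α => (mgfSum_pos hc hp α).ne'
  have hh' : ∀ α, 1 ≤ α → (α - 1) * r - Real.log (mgfSum c f α) ≤ α * h := by
    intro α hα
    rcases hα.eq_or_lt with rfl | hα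
    · have h1 : Tendsto (fun α : ℝ => (α - 1) * r - Real.log (mgfSum c f α)) (𝓝[>] 1)
          (𝓝 ((1 - 1) * r - Real.log (mgfSum c f 1))) :=
        (Continuous.tendsto (by fun_prop) _).mono_left nhdsWithin_le_nhds
      have h2 : Tendsto (fun α : ℝ => α * h) (𝓝[>] 1) (𝓝 (1 * h)) :=
        (Continuous.tendsto (by fun_prop) _).mono_left nhdsWithin_le_nhds
      exact le_of_tendsto_of_tendsto h1 h2 (eventually_nhdsWithin_of_forall fun α hα => hh α hα)
    · exact hh α hα
  have hZ1 : mgfSum c f 1 = 1 := by simpa [mgfSum] using hp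
  set φ : ℝ → ℝ := fun α => α * tiltedMean c f α - Real.log (mgfSum c f α) with hφ
  have hφc : Continuous φ := by
    have := continuous_tiltedMean hc hp
    fun_prop
  by_cases h1 : r ≤ φ 1
  · refine ⟨1, le_rfl, ?_⟩
    have := hh' 1 le_rfl
    rw [hZ1] at this
    rw [max_eq_right (sub_nonpos.mpr h1), hZ1]
    simp at this ⊢
    linarith
  push Not at h1
  set K := max 1 (r / ε) with hK
  have hK1 : 1 ≤ K := le_max_left _ _
  have hKr : r ≤ K * ε := (div_le_iff₀ hε).mp (le_max_right _ _)
  by_cases h2 : r ≤ φ K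
  · obtain ⟨α, hα, hαr⟩ := intermediate_value_Icc hK1 hφc.continuousOn ⟨h1.le, h2⟩
    refine ⟨α, hα.1, ?_⟩
    have e : r - (α * tiltedMean c f α - Real.log (mgfSum c f α)) = 0 := by
      rw [← hαr]; simp [hφ]
    rw [e, max_self, add_zero]
    have h3 := hh' α hα.1
    have hα0 : 0 < α := by linarith [hα.1]
    have h4 : α * ((α - 1) * tiltedMean c f α - Real.log (mgfSum c f α)) ≤ α * h := by
      simp only [hφ] at hαr
      nlinarith
    linarith [le_of_mul_le_mul_left h4 hα0]
  · push Not at h2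
    refine ⟨K, hK1, ?_⟩
    rw [max_eq_left (by simp only [hφ] at h2; linarith)]
    have h3 := hh' K hK1
    have h4 := tilted_relEntropy_nonneg hc hc1 hp K
    have hK0 : 0 < K := by linarith
    have h5 : K * (r - tiltedMean c f K) ≤ K * (h + ε) := by nlinarith
    linarith [le_of_mul_le_mul_left h5 hK0]

/-- Achievability of the strong converse exponent for i.i.d. classical distributions. -/
theorem eventually_exists_classical_test {p q : X → ℝ} (hp0 : ∀ k, 0 ≤ p k) (hq0 : ∀ k, 0 ≤ q k)
    (hp1 : ∑ k, p k = 1) (hq1 : ∑ k, q k = 1) (hpq : ∀ k, q k = 0 → p k = 0) {r h : ℝ}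
    (hh : ∀ α, 1 < α → (α - 1) * r -
      Real.log (∑ k, (suppRpow ((1 - α) / (2 * α)) (q k) ^ 2 * p k) ^ α) ≤ α * h)
    {ε : ℝ} (hε : 0 < ε) :
    ∀ᶠ N : ℕ in atTop, ∃ t : (Fin N → X) → ℝ, (∀ x, 0 ≤ t x) ∧ (∀ x, t x ≤ 1) ∧
      ∑ x, t x * ∏ i, q (x i) ≤ Real.exp (-(N * r)) ∧
      Real.exp (-(N * (h + ε))) ≤ ∑ x, t x * ∏ i, p (x i) := by
  set c : X → ℝ := fun k => if p k = 0 then 0 else q k with hcdef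
  set f : X → ℝ := fun k => Real.log (p k / q k) with hfdef
  have hc : ∀ k, 0 ≤ c k := fun k => by
    simp only [hcdef]; split_ifs
    · exact le_rfl
    · exact hq0 k
  have hc1 : ∑ k, c k ≤ 1 := by
    rw [← hq1]
    refine Finset.sum_le_sum fun k _ => ?_
    simp only [hcdef]; split_ifs
    · exact hq0 k
    · exact le_rfl
  have hpos : ∀ k, p k ≠ 0 → 0 < p k ∧ 0 < q k := fun k hk =>
    ⟨(hp0 k).lt_of_ne' hk, (hq0 k).lt_of_ne' fun h => hk (hpq k h)⟩
  have hcp : ∀ k, c k * Real.exp (f k) = p k := by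
    intro k
    simp only [hcdef, hfdef]
    split_ifs with hk
    · rw [hk, zero_mul]
    · obtain ⟨h1, h2⟩ := hpos k hk
      rw [Real.exp_log (div_pos h1 h2)]
      field_simp
  have hp : ∑ k, c k * Real.exp (f k) = 1 := by simp only [hcp, hp1]
  have hZ : ∀ α, 1 < α → ∑ k, (suppRpow ((1 - α) / (2 * α)) (q k) ^ 2 * p k) ^ α =
      mgfSum c f α := by
    intro α hα
    refine Finset.sum_congr rfl fun k _ => ?_
    simp only [hcdef, hfdef]
    have hα0 : 0 < α := by linarith
    split_ifs with hk
    · rw [hk, mul_zero, zero_mul, Real.zero_rpow hα0.ne']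
    · obtain ⟨h1, h2⟩ := hpos k hk
      rw [suppRpow, if_neg h2.ne', mul_comm α, ← Real.rpow_def_of_pos (div_pos h1 h2),
        Real.div_rpow h1.le h2.le, ← Real.rpow_natCast, ← Real.rpow_mul h2.le,
        Real.mul_rpow (Real.rpow_nonneg h2.le _) h1.le, ← Real.rpow_mul h2.le]
      have : (1 - α) / (2 * α) * ((2 : ℕ) : ℝ) * α = 1 - α := by
        push_cast; field_simp
      rw [this, Real.rpow_sub h2, Real.rpow_one]
      ring
  have hh' : ∀ α, 1 < α → (α - 1) * r - Real.log (mgfSum c f α) ≤ α * h := fun α hα => by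
    rw [← hZ α hα]; exact hh α hα
  obtain ⟨α, hα, hαh⟩ := exists_tilting_parameter hc hc1 hp hh' (ε := ε / 4) (by linarith)
  set E := tiltedMean c f α with hE
  set L := Real.log (mgfSum c f α) with hL
  set δ := ε / (8 * α) with hδ
  have hα0 : 0 < α := by linarith
  have hδ0 : 0 < δ := by positivity
  have hδα : α * δ = ε / 8 := by rw [hδ]; field_simp
  have hmax := le_max_left (r - (α * E - L)) 0
  have hκ : 0 ≤ max (r - (α * E - L)) 0 + α * δ :=
    add_nonneg (le_max_right _ _) (by positivity)
  have ht := eventually_exists_tilted_test hc hp (r := r) hα hδ0 hκ (by linarith)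
  have hhalf : ∀ᶠ N : ℕ in atTop, Real.log 2 ≤ N * (ε / 2) :=
    (tendsto_natCast_atTop_atTop.atTop_mul_const (by linarith : 0 < ε / 2)).eventually_ge_atTop _
  filter_upwards [ht, hhalf] with N hN hN2
  obtain ⟨t, ht0, ht1, htq, htp⟩ := hN
  have hN0 : (0 : ℝ) ≤ N := Nat.cast_nonneg N
  refine ⟨fun x => if ∀ i, p (x i) ≠ 0 then t x else 0, fun x => ?_, fun x => ?_, ?_, ?_⟩
  · dsimp only; split_ifs
    · exact ht0 x
    · exact le_rfl
  · dsimp only; split_ifs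
    · exact ht1 x
    · exact zero_le_one
  · refine le_trans (Finset.sum_le_sum fun x _ => ?_) htq
    dsimp only
    split_ifs with hx
    · refine le_of_eq ?_
      congr 1
      exact Finset.prod_congr rfl fun i _ => by simp only [hcdef, if_neg (hx i)]
    · rw [zero_mul]
      exact mul_nonneg (ht0 x) (Finset.prod_nonneg fun i _ => hc _)
  · have e : ∑ x : Fin N → X, (if ∀ i, p (x i) ≠ 0 then t x else 0) * ∏ i, p (x i) =
        ∑ x : Fin N → X, t x * ∏ i, (c (x i) * Real.exp (f (x i))) := by
      refine Finset.sum_congr rfl fun x _ => ?_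
      simp only [hcp]
      split_ifs with hx
      · rfl
      · push Not at hx
        obtain ⟨i, hi⟩ := hx
        rw [Finset.prod_eq_zero (Finset.mem_univ i) hi, mul_zero, mul_zero]
    rw [e]
    refine le_trans ?_ htp
    have h2 : (1 / 2 : ℝ) = Real.exp (-Real.log 2) := by
      rw [Real.exp_neg, Real.exp_log two_pos, one_div]
    rw [h2, ← Real.exp_add, Real.exp_le_exp]
    have h3 : (α - 1) * (E + δ) - L + (max (r - (α * E - L)) 0 + α * δ) ≤ h + ε / 2 := by
      nlinarith
    have h4 := mul_le_mul_of_nonneg_left h3 hN0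
    linarith

end Classical

section Exponents

open Matrix Filter Topology

variable {n : Type*} [Fintype n] [DecidableEq n]

lemma IsDensityMatrix.trace_re {ρ : Matrix n n ℂ} (hρ : IsDensityMatrix ρ) : ρ.trace.re = 1 := by
  rw [hρ.2, Complex.one_re]

lemma isTest_one : IsTest (1 : Matrix n n ℂ) :=
  ⟨PosSemidef.one, by rw [sub_self]; exact PosSemidef.zero⟩

lemma isTest_zero : IsTest (0 : Matrix n n ℂ) :=
  ⟨PosSemidef.zero, by rw [sub_zero]; exact PosSemidef.one⟩

lemma sandwichedTrace_pos {α : ℝ} (hα : 1 < α) {ρ σ : Matrix n n ℂ} (hρ : IsDensityMatrix ρ)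
    (hσ : σ.PosSemidef) (hs : ρ * matPow σ 0 = ρ) : 0 < sandwichedTrace α ρ σ := by
  obtain ⟨U, q, hU, hq, hq0⟩ := PosSemidef.exists_unitary_realDiag hσ
  have h0 : 0 ≤ sandwichedTrace α ρ σ :=
    (Finset.sum_nonneg fun i _ => Real.rpow_nonneg (mul_nonneg (sq_nonneg _)
      (posSemidef_diag_re_nonneg (posSemidef_conj hρ.1 U) i)) _).trans
      (sum_sandwich_diag_le hα hρ.1 hU hq)
  refine h0.lt_of_ne' fun h => ?_
  have h1 := trace_mul_test_le hα hρ.1 hU hq hq0 hs isTest_one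
  rw [Matrix.mul_one, hρ.trace_re, h, Real.zero_rpow (by positivity), zero_mul, mul_zero] at h1
  linarith

lemma Hstar_eq {ρ σ : Matrix n n ℂ} (hρ : IsDensityMatrix ρ) (hσ : σ.PosSemidef)
    (hsupp : suppLE ρ σ) (r : ℝ) :
    Hstar r ρ σ = ⨆ α ∈ Set.Ioi (1 : ℝ),
      (((((α - 1) * r - Real.log (sandwichedTrace α ρ σ)) / α : ℝ)) : EReal) := by
  unfold Hstar
  refine iSup_congr fun α => iSup_congr fun hα => ?_
  have hα : 1 < α := hα
  have hQ := sandwichedTrace_pos hα hρ hσ (mul_matPow_zero_of_suppLE hσ.isHermitian hsupp)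
  have hD : Dstar α ρ σ = (((α - 1)⁻¹ * Real.log (sandwichedTrace α ρ σ) : ℝ) : EReal) := by
    unfold Dstar Qstar
    rw [if_neg fun h => h.2 hsupp, EReal.coe_mul, ← ENNReal.log_ofReal_of_pos hQ]
    rfl
  rw [hD, ← EReal.coe_sub, ← EReal.coe_mul, EReal.coe_eq_coe_iff]
  have h1 : α - 1 ≠ 0 := by linarith
  have h2 : α ≠ 0 := by linarith
  field_simp

lemma tendsto_mul_log_succ_div (d : ℝ) :
    Tendsto (fun N : ℕ => d * Real.log (N + 1) / N) atTop (𝓝 0) := by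
  have h1 : Tendsto (fun x : ℝ => Real.log x ^ 1 / (1 * x + -1)) atTop (𝓝 0) :=
    Real.tendsto_pow_log_div_mul_add_atTop 1 (-1) 1 one_ne_zero
  have h2 : Tendsto (fun N : ℕ => (N : ℝ) + 1) atTop atTop :=
    tendsto_atTop_add_const_right _ _ tendsto_natCast_atTop_atTop
  have h3 := (h1.comp h2).const_mul d
  rw [mul_zero] at h3
  refine h3.congr fun N => ?_
  simp only [Function.comp, pow_one]
  rw [mul_div_assoc]
  congr 2
  ring

variable {d : ℕ} {ρ σ : Matrix (Fin d) (Fin d) ℂ}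

lemma tensorPow_eq_tpow (A : Matrix (Fin d) (Fin d) ℂ) (N : ℕ) :
    tensorPow A N = tpow (Fin N) A := rfl

/-- The strong converse bound, for finitely many copies. -/
lemma tensorPow_trace_mul_test_le {α : ℝ} (hα : 1 < α) (hρ : IsDensityMatrix ρ)
    (hσ : σ.PosSemidef) (hsupp : suppLE ρ σ) {N : ℕ}
    {T : Matrix (Fin N → Fin d) (Fin N → Fin d) ℂ} (hT : IsTest T) :
    (tensorPow ρ N * T).trace.re ≤ ((N : ℝ) + 1) ^ d *
      ((sandwichedTrace α ρ σ ^ N) ^ (1 / α) *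
        ((tensorPow σ N * T).trace.re) ^ ((α - 1) / α)) := by
  have hs := mul_matPow_zero_of_suppLE hσ.isHermitian hsupp
  have hQ := sandwichedTrace_pos hα hρ hσ hs
  obtain ⟨U, q, hU, hq, hq0⟩ := PosSemidef.exists_unitary_realDiag hσ
  have h1 := trace_mul_test_le hα (tpow_posSemidef (ι := Fin N) hρ.1) (tpow_unitary hU)
    (tpow_spectral hq) (fun x => Finset.prod_nonneg fun i _ => hq0 _)
    (tpow_mul_matPow_zero hσ hs) hT
  rw [sandwichedTrace_tpow hρ.1 hσ, Fintype.card_fin] at h1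
  have hcard := card_image_prod_le (ι := Fin N) q
  rw [Fintype.card_fin, Fintype.card_fin] at hcard
  refine h1.trans (mul_le_mul_of_nonneg_right (by exact_mod_cast hcard) ?_)
  exact mul_nonneg (Real.rpow_nonneg (pow_nonneg hQ.le _) _) (Real.rpow_nonneg
    (trace_mul_posSemidef_nonneg (tpow_posSemidef hσ) hT.1) _)

/-- The converse part: no test sequence beats the Hoeffding anti-divergence. -/
lemma le_liminf_expRate (hρ : IsDensityMatrix ρ) (hσ : σ.PosSemidef) (hsupp : suppLE ρ σ)
    {r : ℝ} {T : (N : ℕ) → Matrix (Fin N → Fin d) (Fin N → Fin d) ℂ} (hT : ∀ N, IsTest (T N))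
    (hr : (r : EReal) ≤ liminf (fun N => expRate N ((tensorPow σ N * T N).trace.re)) atTop)
    {α : ℝ} (hα : 1 < α) :
    ((((α - 1) * r - Real.log (sandwichedTrace α ρ σ)) / α : ℝ) : EReal) ≤
      liminf (fun N => expRate N ((tensorPow ρ N * T N).trace.re)) atTop := by
  have hQ := sandwichedTrace_pos hα hρ hσ (mul_matPow_zero_of_suppLE hσ.isHermitian hsupp)
  set Q := sandwichedTrace α ρ σ with hQdef
  set a := ((α - 1) * r - Real.log Q) / α with ha
  rw [← EReal.ge_of_forall_gt_iff_ge]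
  intro y hy
  have hy : y < a := EReal.coe_lt_coe_iff.mp hy
  set ε := (a - y) / 2 with hε
  have hε0 : 0 < ε := by rw [hε]; linarith
  have e1 : ∀ᶠ N : ℕ in atTop,
      ((r - ε : ℝ) : EReal) < expRate N ((tensorPow σ N * T N).trace.re) :=
    eventually_lt_of_lt_liminf
      (lt_of_lt_of_le (EReal.coe_lt_coe_iff.mpr (by linarith)) hr)
  have e2 := (tendsto_mul_log_succ_div d).eventually_lt_const hε0
  refine le_liminf_of_le (by isBoundedDefault) ?_
  filter_upwards [e1, e2, eventually_ge_atTop 1] with N h1 h2 hN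
  have hN0 : (0 : ℝ) < N := by exact_mod_cast hN
  have hmain := tensorPow_trace_mul_test_le hα hρ hσ hsupp (hT N)
  have hx0 : 0 ≤ (tensorPow ρ N * T N).trace.re :=
    trace_mul_posSemidef_nonneg (tpow_posSemidef hρ.1) (hT N).1
  have hs0 : 0 ≤ (tensorPow σ N * T N).trace.re :=
    trace_mul_posSemidef_nonneg (tpow_posSemidef hσ) (hT N).1
  generalize (tensorPow ρ N * T N).trace.re = x at *
  generalize (tensorPow σ N * T N).trace.re = s at *
  have hα0 : 0 < α := by linarith
  have hu0 : 0 < (α - 1) / α := div_pos (by linarith) hα0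
  have hu1 : (α - 1) / α ≤ 1 := by rw [div_le_one hα0]; linarith
  unfold expRate at h1 ⊢
  split_ifs with hx
  · exact le_top
  have hxpos : 0 < x := hx0.lt_of_ne' hx
  have hs : s ≠ 0 := by
    rintro rfl
    rw [Real.zero_rpow hu0.ne', mul_zero, mul_zero] at hmain
    linarith
  have hspos : 0 < s := hs0.lt_of_ne' hs
  rw [if_neg hs, EReal.coe_lt_coe_iff] at h1
  rw [EReal.coe_le_coe_iff]
  have hlog : Real.log x ≤ d * Real.log (N + 1) + (1 / α) * (N * Real.log Q)
      + (α - 1) / α * Real.log s := by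
    have := Real.log_le_log hxpos hmain
    rw [Real.log_mul (by positivity) (by positivity), Real.log_mul (by positivity) (by positivity),
      Real.log_pow, Real.log_rpow (by positivity), Real.log_pow, Real.log_rpow hspos] at this
    linarith
  have h3 : d * Real.log (N + 1) < ε * N := (div_lt_iff₀ hN0).mp h2
  have h4 : Real.log s < -(N * (r - ε)) := by
    have e : -(N : ℝ)⁻¹ * Real.log s = -Real.log s / N := by field_simp
    rw [e, lt_div_iff₀ hN0] at h1
    linarith
  have e : -(N : ℝ)⁻¹ * Real.log x = -Real.log x / N := by field_simp
  rw [e, le_div_iff₀ hN0]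
  have h5 : (α - 1) / α * Real.log s ≤ (α - 1) / α * (-(N * (r - ε))) :=
    mul_le_mul_of_nonneg_left h4.le hu0.le
  have h6 : (α - 1) / α * (N * ε) ≤ 1 * (N * ε) :=
    mul_le_mul_of_nonneg_right hu1 (by positivity)
  have h7 : a * N = (α - 1) / α * (N * r) - 1 / α * (N * Real.log Q) := by
    rw [ha]; field_simp
  have h8 : y = a - 2 * ε := by rw [hε]; ring
  rw [h8]
  linarith

lemma isTest_conj_realDiag {U : Matrix n n ℂ} (hU : Uᴴ * U = 1) {t : n → ℝ} (h0 : ∀ i, 0 ≤ t i)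
    (h1 : ∀ i, t i ≤ 1) : IsTest (U * realDiag t * Uᴴ) := by
  refine ⟨posSemidef_conj_realDiag U h0, ?_⟩
  have e : 1 - U * realDiag t * Uᴴ = U * realDiag (fun i => 1 - t i) * Uᴴ := by
    have : realDiag (fun i => 1 - t i) = 1 - realDiag t := by
      ext i j
      by_cases h : i = j
      · subst h; simp [realDiag]
      · simp [realDiag, h]
    rw [this, Matrix.mul_sub, Matrix.sub_mul, Matrix.mul_one, mul_conjTranspose_eq_one hU]
  rw [e]
  exact posSemidef_conj_realDiag U fun i => sub_nonneg.mpr (h1 i)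

lemma IsTest.submatrix_equiv {m : Type*} [Fintype m] [DecidableEq m] {T : Matrix n n ℂ}
    (hT : IsTest T) (e : m ≃ n) : IsTest (T.submatrix e e) := by
  refine ⟨hT.1.submatrix e, ?_⟩
  have := hT.2.submatrix e
  rwa [submatrix_sub, Pi.sub_apply, Pi.sub_apply, submatrix_one_equiv] at this

lemma trace_tpow_mul_test {ι : Type*} [Fintype ι] [DecidableEq ι] {A V : Matrix n n ℂ}
    (hA : A.PosSemidef) (hV : Vᴴ * V = 1) (t : (ι → n) → ℝ) :
    (tpow ι A * (tpow ι V * realDiag t * (tpow ι V)ᴴ)).trace.re =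
      ∑ x, t x * ∏ i, ((Vᴴ * A * V) (x i) (x i)).re := by
  rw [trace_mul_conj (tpow_unitary hV), conj_cancel (tpow_unitary hV) rfl,
    ← tpow_conjTranspose, ← tpow_mul, ← tpow_mul, trace_mul_realDiag_re]
  refine Finset.sum_congr rfl fun x _ => ?_
  rw [mul_comm]
  congr 1
  have hreal : ∀ i, (Vᴴ * A * V) i i = (((Vᴴ * A * V) i i).re : ℂ) := fun i => by
    have := (Complex.le_def.mp ((posSemidef_conj hA V).diag_nonneg (i := i))).2
    exact Complex.ext rfl (by simpa using this.symm)
  rw [tpow_apply, Finset.prod_congr rfl fun i _ => hreal (x i), ← Complex.ofReal_prod,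
    Complex.ofReal_re]

/-- Tests on `N` blocks of `m` copies obtained from the pinched classical problem. -/
lemma eventually_exists_block_test (hρ : IsDensityMatrix ρ) (hσ : IsDensityMatrix σ)
    (hsupp : suppLE ρ σ) {r H : ℝ}
    (hH : ∀ α, 1 < α → ((α - 1) * r - Real.log (sandwichedTrace α ρ σ)) / α ≤ H)
    {m : ℕ} (hm : 0 < m) {ε : ℝ} (hε : 0 < ε) :
    ∀ᶠ N : ℕ in atTop,
      ∃ T : Matrix (Fin (N * m) → Fin d) (Fin (N * m) → Fin d) ℂ, IsTest T ∧
        (tensorPow σ (N * m) * T).trace.re ≤ Real.exp (-((N * m : ℕ) * r)) ∧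
        Real.exp (-((N * m : ℕ) * (H + d * Real.log (m + 1) / m + ε))) ≤
          (tensorPow ρ (N * m) * T).trace.re := by
  have hs := mul_matPow_zero_of_suppLE hσ.1.isHermitian hsupp
  obtain ⟨U, q₀, hU, hq, hq0⟩ := PosSemidef.exists_unitary_realDiag hσ.1
  have hρm : (tpow (Fin m) ρ).PosSemidef := tpow_posSemidef hρ.1
  have hσm : (tpow (Fin m) σ).PosSemidef := tpow_posSemidef hσ.1
  have hsm := tpow_mul_matPow_zero (ι := Fin m) hσ.1 hs
  obtain ⟨V, hV, hσV, hoff⟩ := exists_adapted_eigenbasis (tpow_unitary hU)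
    (tpow_spectral (ι := Fin m) hq) hρm.isHermitian
  have hcard := card_image_prod_le (ι := Fin m) q₀
  rw [Fintype.card_fin, Fintype.card_fin] at hcard
  set q : (Fin m → Fin d) → ℝ := fun x => ∏ i, q₀ (x i) with hqdef
  have hq0' : ∀ x, 0 ≤ q x := fun x => Finset.prod_nonneg fun i _ => hq0 _
  set p : (Fin m → Fin d) → ℝ := fun x => ((Vᴴ * tpow (Fin m) ρ * V) x x).re with hpdef
  have hσd : Vᴴ * tpow (Fin m) σ * V = realDiag q := conj_cancel hV hσV
  have hp0 : ∀ x, 0 ≤ p x := posSemidef_diag_re_nonneg (posSemidef_conj hρm V)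
  have htr : ∀ A : Matrix (Fin m → Fin d) (Fin m → Fin d) ℂ,
      ∑ x, ((Vᴴ * A * V) x x).re = A.trace.re := by
    intro A
    have h := trace_mul_conj (A := A) (B := 1) hV
    rw [Matrix.mul_one, Matrix.mul_one, hV, Matrix.mul_one] at h
    rw [h, trace, Complex.re_sum]
    rfl
  have hp1 : ∑ x, p x = 1 := by
    rw [hpdef, htr, trace_tpow, hρ.2, one_pow, Complex.one_re]
  have hqre : ∀ x, ((Vᴴ * tpow (Fin m) σ * V) x x).re = q x := fun x => by
    rw [hσd]; simp [realDiag]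
  have hq1 : ∑ x, q x = 1 := by
    simp only [← hqre]
    rw [htr, trace_tpow, hσ.2, one_pow, Complex.one_re]
  have hpq : ∀ x, q x = 0 → p x = 0 := fun x hx => by
    simp only [hpdef]
    rw [diag_eq_zero_of_supp hV hσV hsm hx, Complex.zero_re]
  have hm0 : (0 : ℝ) < m := by exact_mod_cast hm
  have hh : ∀ α, 1 < α → (α - 1) * (m * r) -
      Real.log (∑ k, (suppRpow ((1 - α) / (2 * α)) (q k) ^ 2 * p k) ^ α) ≤
        α * (m * H + d * Real.log (m + 1)) := by
    intro α hα
    have hα0 : 0 < α := by linarith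
    have h1 := sandwichedTrace_le_sum hα hρm hV hσV hoff
    have hQ := sandwichedTrace_pos hα hρ hσ.1 hs
    rw [sandwichedTrace_tpow hρ.1 hσ.1, Fintype.card_fin] at h1
    have h2 := hH α hα
    rw [div_le_iff₀ hα0] at h2
    set S := ∑ k, (suppRpow ((1 - α) / (2 * α)) (q k) ^ 2 * p k) ^ α with hS
    set Q := sandwichedTrace α ρ σ with hQdef
    have hS0 : 0 ≤ S := Finset.sum_nonneg fun k _ =>
      Real.rpow_nonneg (mul_nonneg (sq_nonneg _) (hp0 k)) _
    have h3 : Q ^ m ≤ (((m : ℝ) + 1) ^ d) ^ α * S := by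
      refine h1.trans (mul_le_mul_of_nonneg_right ?_ hS0)
      exact Real.rpow_le_rpow (Nat.cast_nonneg _) (by exact_mod_cast hcard) hα0.le
    have hSpos : 0 < S := by
      refine hS0.lt_of_ne' fun h => ?_
      rw [h, mul_zero] at h3
      exact absurd h3 (not_le.mpr (pow_pos hQ m))
    have h4 := Real.log_le_log (pow_pos hQ m) h3
    rw [Real.log_mul (by positivity) hSpos.ne', Real.log_rpow (by positivity), Real.log_pow,
      Real.log_pow] at h4
    have h5 := mul_le_mul_of_nonneg_left h2 hm0.le
    linarith
  have hev := eventually_exists_classical_test hp0 hq0' hp1 hq1 hpq hh (mul_pos hm0 hε)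
  filter_upwards [hev] with N hN
  obtain ⟨t, ht0, ht1, htq, htp⟩ := hN
  have htest := isTest_conj_realDiag (tpow_unitary (ι := Fin N) hV) ht0 ht1
  have htrace : ∀ A : Matrix (Fin d) (Fin d) ℂ, A.PosSemidef →
      (tensorPow A (N * m) * (tpow (Fin N) V * realDiag t * (tpow (Fin N) V)ᴴ).submatrix
        (blockEquiv (Fin d) N m) (blockEquiv (Fin d) N m)).trace.re =
      ∑ x, t x * ∏ i, ((Vᴴ * tpow (Fin m) A * V) (x i) (x i)).re := by
    intro A hA
    rw [tensorPow_eq_tpow, tpow_block, submatrix_mul_equiv, ← trace_tpow_mul_test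
      (tpow_posSemidef hA) hV t]
    congr 1
    exact (blockEquiv (Fin d) N m).sum_comp fun x => (tpow (Fin N) (tpow (Fin m) A) *
      (tpow (Fin N) V * realDiag t * (tpow (Fin N) V)ᴴ)) x x
  refine ⟨_, htest.submatrix_equiv (blockEquiv (Fin d) N m), ?_, ?_⟩
  · rw [htrace σ hσ.1]
    simp only [hqre]
    refine htq.trans (le_of_eq ?_)
    push_cast
    congr 1; ring
  · rw [htrace ρ hρ.1]
    refine le_trans (le_of_eq ?_) htp
    push_cast
    congr 1; field_simp

/-- The achievability part, with an error term that vanishes for large block length `m`. -/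
lemma scLow_le_of_block (hρ : IsDensityMatrix ρ) (hσ : IsDensityMatrix σ)
    (hsupp : suppLE ρ σ) {r H : ℝ}
    (hH : ∀ α, 1 < α → ((α - 1) * r - Real.log (sandwichedTrace α ρ σ)) / α ≤ H)
    {m : ℕ} (hm : 0 < m) {ε : ℝ} (hε : 0 < ε) :
    scLow r ρ σ ≤ ((H + d * Real.log (m + 1) / m + ε : ℝ) : EReal) := by
  obtain ⟨N₀, hN₀⟩ := eventually_atTop.mp (eventually_exists_block_test hρ hσ hsupp hH hm hε)
  set h' := H + d * Real.log (m + 1) / m + ε with hh'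
  have hex : ∀ k : ℕ, ∃ T : Matrix (Fin k → Fin d) (Fin k → Fin d) ℂ, IsTest T ∧
      (tensorPow σ k * T).trace.re ≤ Real.exp (-(k * r)) ∧
      ∀ N ≥ N₀, k = N * m → Real.exp (-(k * h')) ≤ (tensorPow ρ k * T).trace.re := by
    intro k
    by_cases hk : ∃ N ≥ N₀, k = N * m
    · obtain ⟨N, hN, rfl⟩ := hk
      obtain ⟨T, hT, h1, h2⟩ := hN₀ N hN
      exact ⟨T, hT, h1, fun _ _ _ => h2⟩
    · refine ⟨0, isTest_zero, ?_, fun N hN h => absurd ⟨N, hN, h⟩ hk⟩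
      rw [Matrix.mul_zero, trace_zero, Complex.zero_re]
      exact (Real.exp_pos _).le
  choose T hT hTσ hTρ using hex
  have hσr : (r : EReal) ≤
      liminf (fun k => expRate k ((tensorPow σ k * T k).trace.re)) atTop := by
    refine le_liminf_of_le (by isBoundedDefault) ?_
    filter_upwards [eventually_ge_atTop 1] with k hk
    have hk0 : (0 : ℝ) < k := by exact_mod_cast hk
    have hs0 : 0 ≤ (tensorPow σ k * T k).trace.re :=
      trace_mul_posSemidef_nonneg (tpow_posSemidef hσ.1) (hT k).1
    have h1 := hTσ k
    generalize (tensorPow σ k * T k).trace.re = s at *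
    unfold expRate
    split_ifs with hs
    · exact le_top
    · have h2 := Real.log_le_log (hs0.lt_of_ne' hs) h1
      rw [Real.log_exp] at h2
      have e : -(k : ℝ)⁻¹ * Real.log s = -Real.log s / k := by field_simp
      rw [EReal.coe_le_coe_iff, e, le_div_iff₀ hk0]
      linarith
  have hsc : scLow r ρ σ ≤
      liminf (fun k => expRate k ((tensorPow ρ k * T k).trace.re)) atTop :=
    sInf_le ⟨T, hT, hσr, rfl⟩
  refine hsc.trans ?_
  refine liminf_le_of_frequently_le ?_ (by isBoundedDefault)
  refine frequently_atTop.mpr fun a => ?_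
  set N := max (max N₀ 1) a with hN
  have hNN₀ : N₀ ≤ N := (le_max_left _ _).trans (le_max_left _ _)
  have hN1 : 1 ≤ N := (le_max_right _ _).trans (le_max_left _ _)
  refine ⟨N * m, (le_max_right _ _).trans (Nat.le_mul_of_pos_right N hm), ?_⟩
  have h1 := hTρ (N * m) N hNN₀ rfl
  have hk0 : (0 : ℝ) < (N * m : ℕ) := by exact_mod_cast Nat.mul_pos hN1 hm
  generalize (tensorPow ρ (N * m) * T (N * m)).trace.re = x at *
  have hx : 0 < x := (Real.exp_pos _).trans_le h1
  have h2 := Real.log_le_log (Real.exp_pos _) h1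
  rw [Real.log_exp] at h2
  have e : -((N * m : ℕ) : ℝ)⁻¹ * Real.log x = -Real.log x / (N * m : ℕ) := by field_simp
  rw [expRate, if_neg hx.ne', EReal.coe_le_coe_iff, e, div_le_iff₀ hk0]
  linarith

lemma scLow_le (hρ : IsDensityMatrix ρ) (hσ : IsDensityMatrix σ) (hsupp : suppLE ρ σ) {r H : ℝ}
    (hH : ∀ α, 1 < α → ((α - 1) * r - Real.log (sandwichedTrace α ρ σ)) / α ≤ H) :
    scLow r ρ σ ≤ H := by
  rw [← EReal.le_of_forall_lt_iff_le]
  intro y hy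
  have hy : H < y := EReal.coe_lt_coe_iff.mp hy
  have hε : 0 < (y - H) / 2 := by linarith
  obtain ⟨m, h1, hm⟩ := (((tendsto_mul_log_succ_div d).eventually_lt_const hε).and
    (eventually_ge_atTop 1)).exists
  refine (scLow_le_of_block hρ hσ hsupp hH hm hε).trans (EReal.coe_le_coe_iff.mpr ?_)
  linarith

end Exponents

end QRD

open QRD in
/-- For density matrices `ρ`, `σ` on `ℂ^d` with `s(ρ) ≤ s(σ)` and every `r ≥ 0`,
the strong converse exponent `sc̲_r(ρ‖σ)` equals the Hoeffding anti-divergence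
`H*_r(ρ‖σ)`. -/
theorem scLow_eq_hoeffdingAntiDivergence
    {d : ℕ} (ρ σ : Matrix (Fin d) (Fin d) ℂ)
    (hρ : IsDensityMatrix ρ) (hσ : IsDensityMatrix σ)
    (hsupp : suppLE ρ σ) (r : ℝ) (hr : 0 ≤ r) :
    scLow r ρ σ = Hstar r ρ σ := by
  rw [Hstar_eq hρ hσ.1 hsupp]
  refine le_antisymm ?_ ?_
  · set S : EReal := ⨆ α ∈ Set.Ioi (1 : ℝ),
      (((((α - 1) * r - Real.log (sandwichedTrace α ρ σ)) / α : ℝ)) : EReal) with hS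
    have hle : ∀ α : ℝ, 1 < α →
        (((((α - 1) * r - Real.log (sandwichedTrace α ρ σ)) / α : ℝ)) : EReal) ≤ S :=
      fun α hα => le_iSup₂_of_le α hα le_rfl
    clear_value S
    induction S using EReal.rec with
    | bot => exact absurd (hle 2 one_lt_two) (not_le.mpr (EReal.bot_lt_coe _))
    | top => exact le_top
    | coe H => exact scLow_le hρ hσ hsupp fun α hα => EReal.coe_le_coe_iff.mp (hle α hα)
  · refine iSup₂_le fun α hα => le_sInf ?_
    rintro x ⟨T, hT, hTr, rfl⟩
    exact le_liminf_expRate hρ hσ.1 hsupp hT hTr hα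
end
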